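/- Let K be a local field, let L/K be a finite Galois extension, and let E/K be a ramified degree-p cyclic extension such that E ⊄ L. Assume that the unique (upper and lower) ramification break v of E/K is not an upper ramification break of L/K. Then the ramification break of the degree-p cyclic extension LE/L is ψ_{L/K}(v). -/

import Mathlib

/-!
STATEMENT 10 (Lemma 4.1 of the paper):
Let K be a local field, L/K a finite Galois extension, and E/K a ramified degree-p cyclic
extension with E ⊄ L.  Assume the unique ramification break v of E/K is not an upper
ramification break of L/K.  Then the ramification break of the degree-p cyclic extension
LE/L is ψ_{L/K}(v); equivalently, φ_{L/K}(break(LE/L)) = v.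
-/

/-- A normalized discrete valuation on a field `K` (so `v(K×) = ℤ`). -/
structure DVal (K : Type*) [Field K] where
  v : K → ℤ
  v_one : v 1 = 0
  v_mul : ∀ x y : K, x ≠ 0 → y ≠ 0 → v (x * y) = v x + v y
  v_add : ∀ x y : K, x ≠ 0 → y ≠ 0 → x + y ≠ 0 → min (v x) (v y) ≤ v (x + y)
  exists_uniformizer : ∃ π : K, π ≠ 0 ∧ v π = 1

/-- `K` is complete with respect to the discrete valuation `vK`. -/
def DVal.IsComplete {K : Type*} [Field K] (vK : DVal K) : Prop :=
  ∀ f : ℕ → K,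
    (∀ N : ℤ, ∃ M : ℕ, ∀ m n : ℕ, M ≤ m → M ≤ n → f m = f n ∨ N ≤ vK.v (f m - f n)) →
    ∃ a : K, ∀ N : ℤ, ∃ M : ℕ, ∀ m : ℕ, M ≤ m → f m = a ∨ N ≤ vK.v (f m - a)

/-- The residue field of `(K, vK)` is perfect (in characteristic `p` this says the
Frobenius is surjective on the residue field). -/
def DVal.PerfectResidue {K : Type*} [Field K] (vK : DVal K) (p : ℕ) : Prop :=
  ∀ x : K, (x = 0 ∨ 0 ≤ vK.v x) →
    ∃ y : K, (y = 0 ∨ 0 ≤ vK.v y) ∧ (x - y ^ p = 0 ∨ 1 ≤ vK.v (x - y ^ p))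

/-- `σ` belongs to the inertia subgroup: it induces the identity on the residue field. -/
def inInertia (K : Type*) {L : Type*} [Field K] [Field L] [Algebra K L]
    (vL : DVal L) (σ : L ≃ₐ[K] L) : Prop :=
  ∀ x : L, (x = 0 ∨ 0 ≤ vL.v x) → (σ x - x = 0 ∨ 1 ≤ vL.v (σ x - x))

/-- The ramification number `i(σ) = v_L(σ(π_L) − π_L) − 1` for `σ` in the inertia group,
and `i(σ) = −1` otherwise. -/
noncomputable def ramNum (K : Type*) {L : Type*} [Field K] [Field L] [Algebra K L]
    (vL : DVal L) (πL : L) (σ : L ≃ₐ[K] L) : ℤ := by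
  classical exact if inInertia K vL σ then vL.v (σ πL - πL) - 1 else -1

/-- The lower ramification set `G_t = {σ : i(σ) ≥ t}` (together with the identity). -/
def lowerSet (K : Type*) {L : Type*} [Field K] [Field L] [Algebra K L]
    (vL : DVal L) (πL : L) (t : ℝ) : Set (L ≃ₐ[K] L) :=
  {σ | σ = 1 ∨ (t ≤ (ramNum K vL πL σ : ℝ))}

/-- `b` is a lower ramification break of `L/K`. -/
def IsLowerBreak (K : Type*) {L : Type*} [Field K] [Field L] [Algebra K L]
    (vL : DVal L) (πL : L) (b : ℝ) : Prop :=
  ∃ σ : L ≃ₐ[K] L, σ ≠ 1 ∧ (ramNum K vL πL σ : ℝ) = b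

/-- The Hasse–Herbrand function `φ_{L/K}(x) = ∫_0^x dt / (G_0 : G_t)`. -/
noncomputable def hherb (K : Type*) {L : Type*} [Field K] [Field L] [Algebra K L]
    (vL : DVal L) (πL : L) (x : ℝ) : ℝ :=
  ∫ t in (0:ℝ)..x,
    (Nat.card ↥(lowerSet K vL πL t) : ℝ) / (Nat.card ↥(lowerSet K vL πL 0) : ℝ)

/-- `u` is an upper ramification break of `L/K`:  `ψ_{L/K}(u)` is a lower break. -/
def IsUpperBreak (K : Type*) {L : Type*} [Field K] [Field L] [Algebra K L]
    (vL : DVal L) (πL : L) (u : ℝ) : Prop :=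
  ∃ b : ℝ, IsLowerBreak K vL πL b ∧ hherb K vL πL b = u


namespace DVal

section basic
variable {K : Type*} [Field K] (w : DVal K)

/-- `x` has valuation at least `n` (with the convention that `0` has infinite valuation). -/
def ge (n : ℤ) (x : K) : Prop := x = 0 ∨ n ≤ w.v x

variable {w}

lemma ge_zero (n : ℤ) : w.ge n 0 := Or.inl rfl

lemma ge_of_le {n : ℤ} {x : K} (h : n ≤ w.v x) : w.ge n x := Or.inr h

lemma ge_self (x : K) : w.ge (w.v x) x := Or.inr le_rfl

lemma ge.le {n : ℤ} {x : K} (h : w.ge n x) (hx : x ≠ 0) : n ≤ w.v x :=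
  h.resolve_left hx

lemma ge.mono {m n : ℤ} {x : K} (h : w.ge n x) (hmn : m ≤ n) : w.ge m x :=
  h.imp id (fun h => hmn.trans h)

lemma ge.mul {m n : ℤ} {x y : K} (hx : w.ge m x) (hy : w.ge n y) : w.ge (m + n) (x * y) := by
  by_cases h0 : x = 0
  · left; simp [h0]
  by_cases h1 : y = 0
  · left; simp [h1]
  right
  rw [w.v_mul x y h0 h1]
  exact add_le_add (hx.le h0) (hy.le h1)

lemma ge.add {n : ℤ} {x y : K} (hx : w.ge n x) (hy : w.ge n y) : w.ge n (x + y) := by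
  by_cases h0 : x = 0
  · simpa [h0] using hy
  by_cases h1 : y = 0
  · simpa [h1] using hx
  by_cases h2 : x + y = 0
  · left; exact h2
  right
  exact (le_min (hx.le h0) (hy.le h1)).trans (w.v_add x y h0 h1 h2)

lemma v_neg_one : w.v (-1) = 0 := by
  have h := w.v_mul (-1) (-1) (by simp) (by simp)
  rw [neg_mul_neg, one_mul, w.v_one] at h
  omega

lemma v_neg (x : K) : w.v (-x) = w.v x := by
  by_cases h0 : x = 0
  · simp [h0]
  rw [← neg_one_mul, w.v_mul _ _ (by simp) h0, v_neg_one, zero_add]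

lemma v_sub_comm (x y : K) : w.v (x - y) = w.v (y - x) := by
  rw [← v_neg, neg_sub]

lemma ge.neg {n : ℤ} {x : K} (hx : w.ge n x) : w.ge n (-x) := by
  rcases hx with h | h
  · left; simp [h]
  · right; rwa [v_neg]

lemma ge.sub {n : ℤ} {x y : K} (hx : w.ge n x) (hy : w.ge n y) : w.ge n (x - y) := by
  rw [sub_eq_add_neg]; exact hx.add hy.neg

lemma ge_one : w.ge 0 1 := Or.inr w.v_one.ge

lemma v_inv {x : K} (hx : x ≠ 0) : w.v x⁻¹ = - w.v x := by
  have h := w.v_mul x x⁻¹ hx (inv_ne_zero hx)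
  rw [mul_inv_cancel₀ hx, w.v_one] at h
  omega

lemma v_div {x y : K} (hx : x ≠ 0) (hy : y ≠ 0) : w.v (x / y) = w.v x - w.v y := by
  rw [div_eq_mul_inv, w.v_mul _ _ hx (inv_ne_zero hy), v_inv hy]; ring

lemma v_pow {x : K} (hx : x ≠ 0) (n : ℕ) : w.v (x ^ n) = n * w.v x := by
  induction n with
  | zero => simp [w.v_one]
  | succ n ih => rw [pow_succ, w.v_mul _ _ (pow_ne_zero _ hx) hx, ih]; push_cast; ring

lemma v_zpow {x : K} (hx : x ≠ 0) (n : ℤ) : w.v (x ^ n) = n * w.v x := by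
  cases n with
  | ofNat n => simpa using v_pow (w := w) hx n
  | negSucc n =>
    rw [zpow_negSucc, v_inv (pow_ne_zero _ hx), v_pow hx, Int.negSucc_eq]; push_cast; ring

lemma v_prod {ι : Type*} (s : Finset ι) (f : ι → K) (h : ∀ i ∈ s, f i ≠ 0) :
    w.v (∏ i ∈ s, f i) = ∑ i ∈ s, w.v (f i) := by
  classical
  induction s using Finset.induction_on with
  | empty => simp [w.v_one]
  | insert a s ha ih =>
    rw [Finset.prod_insert ha, Finset.sum_insert ha, w.v_mul _ _ (h _ (by simp)), ih]
    · intro i hi; exact h i (by simp [hi])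
    · exact Finset.prod_ne_zero_iff.2 (fun i hi => h i (by simp [hi]))

lemma ge_sum {ι : Type*} (s : Finset ι) (f : ι → K) {n : ℤ} (h : ∀ i ∈ s, w.ge n (f i)) :
    w.ge n (∑ i ∈ s, f i) := by
  classical
  induction s using Finset.induction_on with
  | empty => simpa using ge_zero n
  | insert a s ha ih =>
    rw [Finset.sum_insert ha]
    exact (h _ (by simp)).add (ih (fun i hi => h i (by simp [hi])))

lemma ge.pow {x : K} (hx : w.ge 0 x) (n : ℕ) : w.ge 0 (x ^ n) := by
  induction n with
  | zero => simpa using ge_one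
  | succ n ih => rw [pow_succ]; simpa using ih.mul hx

/-- If `v x < v y` (as extended valuations) then `v (x + y) = v x`. -/
lemma v_add_of_lt {x y : K} (hx : x ≠ 0) (hy : w.ge (w.v x + 1) y) :
    x + y ≠ 0 ∧ w.v (x + y) = w.v x := by
  have hne : x + y ≠ 0 := by
    intro h
    have hy' : y = -x := by linear_combination h
    have := hy.le (by simpa [hy'] using hx)
    rw [hy', v_neg] at this
    omega
  refine ⟨hne, le_antisymm ?_ ?_⟩
  · by_contra hlt
    push Not at hlt
    have h1 : w.ge (w.v x + 1) (x + y) := ge_of_le hlt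
    have h2 := (h1.sub hy).le (by simpa using hx)
    simp at h2
  · exact ((ge_self x).add (hy.mono (by omega))).le hne

variable (w) in
/-- The valuation ring. -/
def O : ValuationSubring K where
  carrier := {x | w.ge 0 x}
  mul_mem' := fun {a b} ha hb => by simpa using ge.mul ha hb
  one_mem' := ge_one
  add_mem' := fun {a b} ha hb => ge.add ha hb
  zero_mem' := ge_zero 0
  neg_mem' := fun {a} ha => ge.neg ha
  mem_or_inv_mem' := fun x => by
    by_cases h0 : x = 0
    · left; left; exact h0
    rcases le_total 0 (w.v x) with h | h
    · left; right; exact h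
    · right; right; rw [v_inv h0]; omega

lemma mem_O {x : K} : x ∈ w.O ↔ w.ge 0 x := Iff.rfl

lemma isUnit_O {x : w.O} : IsUnit x ↔ ((x : K) ≠ 0 ∧ w.v (x : K) = 0) := by
  constructor
  · rintro ⟨u, rfl⟩
    have h1 : ((u : w.O) : K) * ((u⁻¹ : w.Oˣ) : w.O) = 1 := by
      exact_mod_cast congrArg Subtype.val (Units.mul_inv u)
    have hu : ((u : w.O) : K) ≠ 0 := left_ne_zero_of_mul_eq_one h1
    have hu' : (((u⁻¹ : w.Oˣ) : w.O) : K) ≠ 0 := right_ne_zero_of_mul_eq_one h1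
    refine ⟨hu, ?_⟩
    have h2 := w.v_mul _ _ hu hu'
    rw [h1, w.v_one] at h2
    have h3 := ge.le (mem_O.1 (u : w.O).2) hu
    have h4 := ge.le (mem_O.1 ((u⁻¹ : w.Oˣ) : w.O).2) hu'
    omega
  · rintro ⟨h0, h1⟩
    refine IsUnit.of_mul_eq_one ⟨(x : K)⁻¹, Or.inr (by rw [v_inv h0]; omega)⟩ ?_
    ext; simp [h0]

lemma mem_maximalIdeal_O {x : w.O} : x ∈ IsLocalRing.maximalIdeal w.O ↔ w.ge 1 (x : K) := by
  rw [IsLocalRing.mem_maximalIdeal, mem_nonunits_iff, isUnit_O]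
  have := mem_O.1 x.2
  constructor
  · intro h
    by_cases h0 : (x : K) = 0
    · left; exact h0
    · right
      have := this.le h0
      have : w.v (x : K) ≠ 0 := fun h' => h ⟨h0, h'⟩
      omega
  · rintro h ⟨h0, h1⟩
    have := h.le h0
    omega

lemma dvd_O {x y : w.O} (hx : (x : K) ≠ 0) (h : w.ge (w.v (x : K)) (y : K)) : x ∣ y := by
  refine ⟨⟨(y : K) / x, ?_⟩, ?_⟩
  · rw [mem_O, div_eq_mul_inv]
    have := h.mul (ge_self (w := w) (x : K)⁻¹)
    rwa [v_inv hx, add_neg_cancel] at this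
  · ext; simp; field_simp

instance : IsDiscreteValuationRing w.O := by
  apply IsDiscreteValuationRing.ofHasUnitMulPowIrreducibleFactorization
  obtain ⟨π, h0, h1⟩ := w.exists_uniformizer
  refine ⟨⟨π, Or.inr (by omega)⟩, ?_, ?_⟩
  · constructor
    · rw [isUnit_O]; rintro ⟨-, h⟩; simp [h1] at h
    · intro a b hab
      have hab' : π = (a : K) * b := congrArg Subtype.val hab
      have ha : (a : K) ≠ 0 := by rintro h; simp [h] at hab'; exact h0 hab'
      have hb : (b : K) ≠ 0 := by rintro h; simp [h] at hab'; exact h0 hab'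
      have h2 := w.v_mul _ _ ha hb
      rw [← hab', h1] at h2
      have h3 := ge.le (mem_O.1 a.2) ha
      have h4 := ge.le (mem_O.1 b.2) hb
      rw [isUnit_O, isUnit_O]
      by_cases h5 : w.v (a : K) = 0
      · left; exact ⟨ha, h5⟩
      · right; exact ⟨hb, by omega⟩
  · intro x hx
    have hx' : (x : K) ≠ 0 := by simpa using hx
    have h3 := ge.le (mem_O.1 x.2) hx'
    refine ⟨(w.v (x : K)).toNat, ?_⟩
    have hv : w.v (π ^ (w.v (x : K)).toNat) = w.v (x : K) := by
      rw [v_pow h0, h1]; omega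
    apply associated_of_dvd_dvd
    · apply dvd_O
      · simp [h0]
      · right; simpa using hv.le
    · apply dvd_O hx'
      right; simpa using hv.ge

end basic
end DVal


section ringlevel

open IsLocalRing Polynomial

/-- The residue field is perfect of characteristic `p`, elementary form. -/
def ResPerf (A : Type*) [CommRing A] [IsLocalRing A] (p : ℕ) : Prop :=
  (p : A) ∈ maximalIdeal A ∧ ∀ a : A, ∃ b : A, a - b ^ p ∈ maximalIdeal A

lemma ResPerf.perfectField {A : Type*} [CommRing A] [IsLocalRing A] {p : ℕ} (hp : p.Prime)
    (h : ResPerf A p) : PerfectField (ResidueField A) := by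
  have := Fact.mk hp
  have hc : CharP (ResidueField A) p := by
    rw [CharP.charP_iff_prime_eq_zero hp]
    have := (residue_eq_zero_iff (p : A)).2 h.1
    simpa using this
  have : ExpChar (ResidueField A) p := ExpChar.prime hp
  have : PerfectRing (ResidueField A) p := by
    apply PerfectRing.ofSurjective
    intro x
    obtain ⟨a, rfl⟩ := residue_surjective x
    obtain ⟨b, hb⟩ := h.2 a
    refine ⟨residue A b, ?_⟩
    have := (residue_eq_zero_iff _).2 hb
    rw [map_sub, map_pow, sub_eq_zero] at this
    simpa [frobenius_def] using this.symm
  exact PerfectRing.toPerfectField (ResidueField A) p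

variable {A B : Type*} [CommRing A] [CommRing B] [IsDomain A] [IsDomain B]
  [IsDiscreteValuationRing A] [IsDiscreteValuationRing B] [Algebra A B] [Module.Finite A B]
  [FaithfulSMul A B] [IsLocalHom (algebraMap A B)]

theorem exists_gen_ring (p : ℕ) (hp : p.Prime) (h : ResPerf A p) :
    ∃ x : B, Algebra.adjoin A {x} = ⊤ := by
  have := h.perfectField hp
  obtain ⟨β₀, hβ₀⟩ := Field.exists_primitive_element (ResidueField A) (ResidueField B)
  obtain ⟨π, hπ⟩ := IsDiscreteValuationRing.exists_irreducible B
  have hm : maximalIdeal B = Ideal.span {π} := hπ.maximalIdeal_eq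
  obtain ⟨y, hy⟩ := residue_surjective (R := B) β₀
  obtain ⟨q, hq⟩ := Polynomial.map_surjective (residue A) residue_surjective
    (minpoly (ResidueField A) β₀)
  have haev : ∀ (z : B) (r : A[X]), residue B (aeval z r) = aeval (residue B z) (r.map (residue A)) :=
    fun z r => map_aeval_eq_aeval_map (ψ := residue B) (φ := residue A) rfl r z
  have hqy : ∀ z : B, residue B z = β₀ → aeval z q ∈ maximalIdeal B := by
    intro z hz
    rw [← residue_eq_zero_iff, haev, hz, hq, minpoly.aeval]
  have hq' : IsUnit (aeval y (derivative q)) := by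
    have hsep : (minpoly (ResidueField A) β₀).Separable := Algebra.IsSeparable.isSeparable _ _
    have h1 := hsep.aeval_derivative_ne_zero (x := β₀) (minpoly.aeval _ β₀)
    rw [← hq, derivative_map, ← hy, ← haev] at h1
    simpa [residue_ne_zero_iff_isUnit] using h1
  -- find x with q(x) a uniformizer
  obtain ⟨x, hx, hqx⟩ : ∃ x : B, residue B x = β₀ ∧ Associated π (aeval x q) := by
    obtain ⟨c, hc⟩ := Ideal.mem_span_singleton'.1 (hm ▸ hqy y hy)
    by_cases hcu : IsUnit c
    · refine ⟨y, hy, ?_⟩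
      rw [← hc, mul_comm]
      exact (associated_mul_unit_right π c hcu)
    · refine ⟨y + π, ?_, ?_⟩
      · rw [map_add, hy, (residue_eq_zero_iff π).2 (hm ▸ Ideal.mem_span_singleton_self π), add_zero]
      · obtain ⟨k, hk⟩ := (q.map (algebraMap A B)).binomExpansion y π
        rw [eval_map_algebraMap, derivative_map, eval_map_algebraMap, eval_map_algebraMap] at hk
        rw [hk, ← hc, show c * π + aeval y (derivative q) * π + k * π ^ 2 =
          π * (aeval y (derivative q) + (c + k * π)) by ring]
        apply associated_mul_unit_right
        have h2 : c + k * π ∈ maximalIdeal B := by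
          refine Ideal.add_mem _ hcu (Ideal.mul_mem_left _ _ (hm ▸ Ideal.mem_span_singleton_self π))
        by_contra hnu
        have h3 := Ideal.sub_mem _ ((mem_maximalIdeal _).2 hnu) h2
        rw [add_sub_cancel_right] at h3
        exact h3 hq'
  refine ⟨x, ?_⟩
  set S := Algebra.adjoin A {x} with hS
  have hmx : maximalIdeal B = Ideal.span {aeval x q} := by
    rw [hm]; exact Ideal.span_singleton_eq_span_singleton.2 hqx
  have hstep : ∀ b : B, ∃ s ∈ S, ∃ c : B, b = s + aeval x q * c := by
    intro b
    have htop : Algebra.adjoin (ResidueField A) {β₀} = ⊤ := by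
      rw [← IntermediateField.adjoin_simple_toSubalgebra_of_isAlgebraic (IsAlgebraic.of_finite _ _),
        hβ₀, IntermediateField.top_toSubalgebra]
    rw [Algebra.adjoin_singleton_eq_range_aeval, AlgHom.range_eq_top] at htop
    obtain ⟨r, hr⟩ := htop (residue B b)
    obtain ⟨r, rfl⟩ := Polynomial.map_surjective _ residue_surjective r
    rw [← hx, ← haev] at hr
    have : b - aeval x r ∈ maximalIdeal B := by
      rw [← residue_eq_zero_iff, map_sub, hr, sub_self]
    rw [hmx] at this
    obtain ⟨c, hc⟩ := Ideal.mem_span_singleton'.1 this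
    refine ⟨aeval x r, ?_, c, by linear_combination -hc⟩
    rw [hS, Algebra.adjoin_singleton_eq_range_aeval]; exact ⟨r, rfl⟩
  have hqS : aeval x q ∈ S := by
    rw [hS, Algebra.adjoin_singleton_eq_range_aeval]; exact ⟨q, rfl⟩
  have hpow : ∀ n : ℕ, ∀ b : B, ∃ s ∈ S, ∃ c : B, b = s + (aeval x q) ^ n * c := by
    intro n
    induction n with
    | zero => intro b; exact ⟨0, S.zero_mem, b, by simp⟩
    | succ n ih =>
      intro b
      obtain ⟨s, hs, c, hc⟩ := ih b
      obtain ⟨s', hs', c', hc'⟩ := hstep c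
      refine ⟨s + (aeval x q) ^ n * s', S.add_mem hs (S.mul_mem (S.pow_mem hqS n) hs'), c', ?_⟩
      rw [hc, hc']; ring
  have hne : (maximalIdeal A).map (algebraMap A B) ≠ ⊥ := by
    intro h0
    rw [Ideal.map_eq_bot_iff_of_injective (FaithfulSMul.algebraMap_injective A B)] at h0
    exact IsDiscreteValuationRing.not_a_field A h0
  have hirr : Irreducible (aeval x q) := hqx.irreducible hπ
  obtain ⟨n, hn⟩ := IsDiscreteValuationRing.ideal_eq_span_pow_irreducible hne hirr
  rw [← Algebra.toSubmodule_eq_top]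
  apply eq_top_iff.mpr <| Submodule.le_of_le_smul_of_le_jacobson_bot
      (Module.finite_def.mp inferInstance) (IsLocalRing.maximalIdeal_le_jacobson ⊥)
      (?_ : ⊤ ≤ (Subalgebra.toSubmodule S) ⊔ maximalIdeal A • ⊤)
  intro b _
  obtain ⟨s, hs, c, hc⟩ := hpow n b
  rw [Ideal.smul_top_eq_map]
  refine Submodule.mem_sup.mpr ⟨s, hs, aeval x q ^ n * c, ?_, hc.symm⟩
  rw [Submodule.restrictScalars_mem, hn]
  exact Ideal.mul_mem_right _ _ (Ideal.mem_span_singleton_self _)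

variable {G : Type*} [Group G] [Finite G] [MulSemiringAction G B] [IsGaloisGroup G A B]

open scoped Pointwise

theorem card_inertia_ring (e : ℕ)
    (he : (maximalIdeal A).map (algebraMap A B) = maximalIdeal B ^ e) :
    e ∣ Nat.card ((maximalIdeal B).inertia G) ∧
    ∀ p : ℕ, p.Prime → ResPerf A p → Nat.card ((maximalIdeal B).inertia G) = e := by
  set P := maximalIdeal B
  set m := maximalIdeal A
  have hPm : P.LiesOver m := inferInstance
  have hne : m.map (algebraMap A B) ≠ ⊥ := by
    intro h0
    rw [Ideal.map_eq_bot_iff_of_injective (FaithfulSMul.algebraMap_injective A B)] at h0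
    exact IsDiscreteValuationRing.not_a_field A h0
  have hP0 : P ≠ ⊥ := IsDiscreteValuationRing.not_a_field B
  have hram : P.ramificationIdx A = e := by
    rw [Ideal.IsDedekindDomain.ramificationIdx_eq_multiplicity m P hne, he]
    apply multiplicity_pow_self_of_prime
    exact Ideal.prime_of_isPrime hP0 inferInstance
  have huniq : m.primesOver B = {P} := by
    ext Q
    simp only [Set.mem_singleton_iff]
    constructor
    · rintro ⟨hQ, hQm⟩
      have hQ0 : Q ≠ ⊥ := by
        rintro rfl
        have h1 := hQm.over
        rw [Ideal.under_bot] at h1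
        exact IsDiscreteValuationRing.not_a_field A h1
      exact eq_maximalIdeal (hQ.isMaximal hQ0)
    · rintro rfl; exact ⟨inferInstance, hPm⟩
  have hfund := Ideal.ncard_primesOver_mul_ramificationIdxIn_mul_inertiaDegIn m B G
  rw [huniq, Set.ncard_singleton, one_mul, Ideal.ramificationIdxIn_eq_ramificationIdx m P G,
    Ideal.inertiaDegIn_eq_inertiaDeg m P G, hram] at hfund
  have hf : P.inertiaDeg A = Module.finrank (ResidueField A) (ResidueField B) :=
    Ideal.inertiaDeg_eq_of_isMaximal m P
  have hstab : MulAction.stabilizer G P = ⊤ := by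
    rw [eq_top_iff]
    intro g _
    rw [MulAction.mem_stabilizer_iff]
    ext x
    rw [Ideal.mem_pointwise_smul_iff_inv_smul_mem]
    simp only [P, mem_maximalIdeal, mem_nonunits_iff]
    exact not_congr (isUnit_map_iff (MulSemiringAction.toRingEquiv G B g⁻¹) x)
  have hidx : Subgroup.index _ = _ := Nat.card_congr
    (Ideal.Quotient.stabilizerQuotientInertiaEquiv G m P).toEquiv
  have hcard : Nat.card (P.inertia G) * Nat.card (Gal((ResidueField B)/(ResidueField A))) =
      Nat.card G := by
    have h1 := ((P.inertia G).subgroupOf (MulAction.stabilizer G P)).card_mul_index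
    rw [Nat.card_congr (Subgroup.subgroupOfEquivOfLe
      (Ideal.inertia_le_stabilizer (M := G) P)).toEquiv] at h1
    rw [AddSubgroup.subgroupOf_inertia] at h1
    rw [hidx] at h1
    rw [hstab, Subgroup.card_top] at h1
    exact h1
  have hpos : 0 < Module.finrank (ResidueField A) (ResidueField B) := Module.finrank_pos
  constructor
  · obtain ⟨d, hd⟩ : Nat.card (Gal((ResidueField B)/(ResidueField A))) ∣
        Module.finrank (ResidueField A) (ResidueField B) := by
      have h1 := IntermediateField.finrank_fixedField_eq_card
        (⊤ : Subgroup (Gal((ResidueField B)/(ResidueField A))))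
      rw [Subgroup.card_top] at h1
      rw [← h1]
      exact Dvd.intro_left _ (Module.finrank_mul_finrank _ _ _)
    rw [← hfund, hf, hd] at hcard
    refine ⟨d, ?_⟩
    have h0 : Nat.card (Gal((ResidueField B)/(ResidueField A))) ≠ 0 := by
      rintro h0; rw [h0, zero_mul] at hd; omega
    apply mul_right_cancel₀ h0
    rw [hcard]; ring
  · intro p hp hperf
    have := hperf.perfectField hp
    have hn : Normal (ResidueField A) (ResidueField B) :=
      Ideal.Quotient.normal G m P
    have : IsGalois (ResidueField A) (ResidueField B) := { }
    rw [IsGalois.card_aut_eq_finrank, ← hfund, hf] at hcard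
    exact mul_right_cancel₀ hpos.ne' hcard

end ringlevel


namespace DVal

open IsLocalRing Polynomial

/-- `w` on `L` extends `u` on `K` with ramification index `e` and is Galois invariant. -/
structure Ext {K L : Type*} [Field K] [Field L] [Algebra K L] (u : DVal K) (w : DVal L) (e : ℕ) :
    Prop where
  map : ∀ x : K, x ≠ 0 → w.v (algebraMap K L x) = e * u.v x
  inv : ∀ (σ : L ≃ₐ[K] L) (x : L), w.v (σ x) = w.v x

section
variable {K L : Type*} [Field K] [Field L] [Algebra K L] [FiniteDimensional K L] [IsGalois K L]
  {u : DVal K} {w : DVal L} {e : ℕ}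

lemma Ext.inv_ge (h : Ext u w e) (σ : L ≃ₐ[K] L) {n : ℤ} {x : L} : w.ge n (σ x) ↔ w.ge n x := by
  unfold ge
  rw [h.inv σ x]
  simp

lemma Ext.dvd_card (h : Ext u w e) : e ∣ Module.finrank K L := by
  obtain ⟨π, h0, h1⟩ := w.exists_uniformizer
  have h2 := Algebra.norm_eq_prod_automorphisms K π
  have h3 : w.v (algebraMap K L (Algebra.norm K π)) = Module.finrank K L := by
    rw [h2, v_prod]
    · simp only [h.inv, h1]
      simp [IsGalois.card_aut_eq_finrank, ← Nat.card_eq_fintype_card]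
    · intro i _; simpa using h0
  rw [h.map _ (by simpa [Algebra.norm_eq_zero_iff] using h0)] at h3
  exact Int.natCast_dvd_natCast.1 ⟨_, h3.symm⟩

lemma Ext.pos (h : Ext u w e) : 0 < e :=
  Nat.pos_of_dvd_of_pos h.dvd_card Module.finrank_pos

lemma Ext.ge_map (h : Ext u w e) {x : K} : w.ge 0 (algebraMap K L x) ↔ u.ge 0 x := by
  unfold ge
  have := h.pos
  by_cases h0 : x = 0
  · simp [h0]
  rw [h.map x h0]
  have : (0:ℤ) < e := by exact_mod_cast this
  simp [h0, mul_nonneg_iff_of_pos_left this]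

lemma Ext.ge_map1 (h : Ext u w e) {x : K} : w.ge 1 (algebraMap K L x) ↔ u.ge 1 x := by
  unfold ge
  have := h.pos
  by_cases h0 : x = 0
  · simp [h0]
  rw [h.map x h0]
  have h1 : (0:ℤ) < e := by exact_mod_cast this
  have : ∀ a : ℤ, 1 ≤ a ↔ 0 < a := fun a => by omega
  simp only [map_eq_zero, h0, this, false_or]
  exact mul_pos_iff_of_pos_left h1

/-- all the ring level facts -/
theorem Ext.main (h : Ext u w e) :
    (e ∣ Nat.card {σ : L ≃ₐ[K] L // inInertia K w σ}) ∧
    ∀ p : ℕ, p.Prime → ResPerf u.O p →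
      ResPerf w.O p ∧
      Nat.card {σ : L ≃ₐ[K] L // inInertia K w σ} = e ∧
      ∃ x : L, w.ge 0 x ∧ ∀ y : L, w.ge 0 y → ∃ g : K[X], (∀ n, u.ge 0 (g.coeff n)) ∧
        aeval x g = y := by
  classical
  let f : u.O →+* w.O := (((algebraMap K L).comp u.O.subtype).codRestrict w.O
    (fun x => h.ge_map.2 x.2))
  letI : Algebra u.O w.O := f.toAlgebra
  letI : Algebra u.O L := ((algebraMap K L).comp u.O.subtype).toAlgebra
  have hfv : ∀ x : u.O, ((algebraMap u.O w.O x : w.O) : L) = algebraMap K L (x : K) := fun _ => rfl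
  haveI : IsScalarTower u.O K L := IsScalarTower.of_algebraMap_eq (fun _ => rfl)
  haveI : IsScalarTower u.O w.O L := IsScalarTower.of_algebraMap_eq (fun _ => rfl)
  haveI : FaithfulSMul u.O w.O := by
    rw [faithfulSMul_iff_algebraMap_injective]
    intro a b hab
    have := congrArg Subtype.val hab
    rw [hfv, hfv] at this
    exact Subtype.ext ((algebraMap K L).injective this)
  haveI : IsLocalHom (algebraMap u.O w.O) := by
    constructor
    intro a ha
    by_contra hna
    have h1 : (a : u.O) ∈ maximalIdeal u.O := hna
    rw [mem_maximalIdeal_O, ← h.ge_map1, ← hfv, ← mem_maximalIdeal_O] at h1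
    exact h1 ha
  let G := L ≃ₐ[K] L
  letI : MulSemiringAction G w.O :=
    { smul := fun g x => ⟨g (x : L), (h.inv_ge g).2 x.2⟩
      one_smul := fun x => rfl
      mul_smul := fun g g' x => rfl
      smul_zero := fun g => Subtype.ext (map_zero g)
      smul_add := fun g x y => Subtype.ext (map_add g _ _)
      smul_one := fun g => Subtype.ext (map_one g)
      smul_mul := fun g x y => Subtype.ext (map_mul g _ _) }
  have hsm : ∀ (g : G) (x : w.O), ((g • x : w.O) : L) = g (x : L) := fun _ _ => rfl
  haveI : IsGaloisGroup G u.O w.O :=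
    { faithful := by
        constructor
        intro g g' hgg
        have hO : ∀ x : L, w.ge 0 x → g x = g' x := fun x hx =>
          congrArg Subtype.val (hgg ⟨x, hx⟩)
        ext x
        by_cases hx0 : x = 0
        · simp [hx0]
        rcases le_total 0 (w.v x) with hx | hx
        · exact hO x (Or.inr hx)
        · have := hO x⁻¹ (Or.inr (by rw [v_inv hx0]; omega))
          rw [map_inv₀, map_inv₀] at this
          exact inv_injective this
      commutes := ⟨fun g a x => by
        apply Subtype.ext
        rw [hsm, Algebra.smul_def, Algebra.smul_def]
        have : g (algebraMap K L (a : K)) = algebraMap K L (a : K) := AlgEquiv.commutes g _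
        simp [hfv, hsm, this]⟩
      isInvariant := ⟨fun b hb => by
        obtain ⟨x, hx⟩ := (IsGalois.mem_bot_iff_fixed (F := K) (b : L)).2
          (fun g => congrArg Subtype.val (hb g))
        have hx' : algebraMap K L x = b := hx
        exact ⟨⟨x, h.ge_map.1 (by rw [hx']; exact b.2)⟩, Subtype.ext hx'⟩⟩ }
  haveI : Algebra.IsInvariant u.O w.O G := inferInstance
  haveI : Algebra.IsIntegral u.O w.O := Algebra.IsInvariant.isIntegral u.O w.O G
  haveI : IsIntegralClosure w.O u.O L := by
    constructor
    · exact Subtype.val_injective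
    · intro x
      constructor
      · intro hx
        have : IsIntegral w.O x := hx.tower_top
        exact IsIntegrallyClosed.isIntegral_iff.1 this
      · rintro ⟨y, rfl⟩
        exact (Algebra.IsIntegral.isIntegral (R := u.O) y).algebraMap
  haveI : Module.Finite u.O w.O := IsIntegralClosure.finite u.O K L w.O
  have he : (maximalIdeal u.O).map (algebraMap u.O w.O) = maximalIdeal w.O ^ e := by
    obtain ⟨π, hπ0, hπ1⟩ := u.exists_uniformizer
    obtain ⟨ϖ, hϖ0, hϖ1⟩ := w.exists_uniformizer
    have h1 : maximalIdeal u.O = Ideal.span {(⟨π, Or.inr (by omega)⟩ : u.O)} := by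
      apply le_antisymm
      · intro x hx
        rw [Ideal.mem_span_singleton]
        exact dvd_O hπ0 (by rw [hπ1]; exact mem_maximalIdeal_O.1 hx)
      · rw [Ideal.span_singleton_le_iff_mem, mem_maximalIdeal_O]; exact Or.inr hπ1.ge
    have h2 : maximalIdeal w.O = Ideal.span {(⟨ϖ, Or.inr (by omega)⟩ : w.O)} := by
      apply le_antisymm
      · intro x hx
        rw [Ideal.mem_span_singleton]
        exact dvd_O hϖ0 (by rw [hϖ1]; exact mem_maximalIdeal_O.1 hx)
      · rw [Ideal.span_singleton_le_iff_mem, mem_maximalIdeal_O]; exact Or.inr hϖ1.ge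
    rw [h1, h2, Ideal.map_span, Set.image_singleton, Ideal.span_singleton_pow,
      Ideal.span_singleton_eq_span_singleton]
    have e1 : w.v (ϖ ^ e) = e := by rw [v_pow hϖ0, hϖ1, mul_one]
    have e2 : w.v (algebraMap K L π) = e := by rw [h.map π hπ0, hπ1, mul_one]
    apply associated_of_dvd_dvd
    · apply dvd_O
      · rw [hfv]; simpa using hπ0
      · rw [hfv]; right; simp [e1, e2]
    · apply dvd_O
      · simpa using fun h => absurd h hϖ0
      · rw [hfv]; right; simp [e1, e2]
  have hin : Nat.card ((maximalIdeal w.O).inertia G) =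
      Nat.card {σ : L ≃ₐ[K] L // inInertia K w σ} := by
    apply Nat.card_congr
    refine Equiv.subtypeEquivRight (fun g => ?_)
    constructor
    · intro hg x hx
      exact mem_maximalIdeal_O.1 (hg ⟨x, hx⟩)
    · intro hg x
      exact mem_maximalIdeal_O.2 (hg x x.2)
  have hc := card_inertia_ring (G := G) e he
  rw [hin] at hc
  refine ⟨hc.1, fun p hp hr => ⟨?_, hc.2 p hp hr, ?_⟩⟩
  · have hpf := hr.perfectField hp
    have hpm : (p : w.O) ∈ maximalIdeal w.O := by
      have := hr.1
      rw [mem_maximalIdeal_O] at this ⊢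
      simpa using h.ge_map1.2 this
    refine ⟨hpm, ?_⟩
    have hpf' : PerfectField (ResidueField w.O) :=
      Algebra.IsAlgebraic.perfectField (K := ResidueField u.O)
    have := Fact.mk hp
    have hc : CharP (ResidueField w.O) p := by
      rw [CharP.charP_iff_prime_eq_zero hp]
      have := (residue_eq_zero_iff (p : w.O)).2 hpm
      simpa using this
    have : ExpChar (ResidueField w.O) p := ExpChar.prime hp
    have := PerfectField.toPerfectRing (K := ResidueField w.O) p
    intro a
    obtain ⟨b, hb⟩ := surjective_frobenius (ResidueField w.O) p (residue _ a)
    obtain ⟨b, rfl⟩ := residue_surjective b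
    refine ⟨b, ?_⟩
    rw [← residue_eq_zero_iff, map_sub, map_pow, ← hb, frobenius_def, sub_self]
  · obtain ⟨x, hx⟩ := exists_gen_ring (A := u.O) (B := w.O) p hp hr
    refine ⟨x, x.2, fun y hy => ?_⟩
    have : (⟨y, hy⟩ : w.O) ∈ Algebra.adjoin u.O {x} := hx ▸ Algebra.mem_top
    rw [Algebra.adjoin_singleton_eq_range_aeval] at this
    obtain ⟨g, hg⟩ := this
    refine ⟨g.map u.O.subtype, fun n => ?_, ?_⟩
    · rw [coeff_map]; exact (g.coeff n).2
    · have : ((aeval x g : w.O) : L) = y := congrArg Subtype.val hg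
      rw [← this]
      refine (aeval_map_algebraMap (B := L) (A := K) (R := u.O) (x : L) g).trans ?_
      exact aeval_algebraMap_apply L x g

end
end DVal


namespace DVal

open IsLocalRing Polynomial

section
variable {K L : Type*} [Field K] [Field L] [Algebra K L] {w : DVal L}

lemma ge.pow_sub {n : ℤ} {a b : L} (ha : w.ge 0 a) (hb : w.ge 0 b) (h : w.ge n (a - b)) (k : ℕ) :
    w.ge n (a ^ k - b ^ k) := by
  induction k with
  | zero => simpa using ge_zero n
  | succ k ih =>
    have : a ^ (k+1) - b ^ (k+1) = a ^ k * (a - b) + (a ^ k - b ^ k) * b := by ring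
    rw [this]
    exact (by simpa using (ha.pow k).mul h : w.ge n (a ^ k * (a - b))).add
      (by simpa using ih.mul hb)

lemma ge.sub_prime_pow {p : ℕ} (hr : ResPerf w.O p) {n : ℤ} {a b : L} (ha : w.ge 0 a)
    (hb : w.ge 0 b) (h : w.ge n (a - b)) (hn : 1 ≤ n) : w.ge (n + 1) (a ^ p - b ^ p) := by
  rw [← (Commute.all a b).mul_geom_sum₂]
  apply h.mul
  have h1 : ∑ i ∈ Finset.range p, a ^ i * b ^ (p - 1 - i) =
      ∑ i ∈ Finset.range p, (a ^ i - b ^ i) * b ^ (p - 1 - i) +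
      ∑ i ∈ Finset.range p, b ^ i * b ^ (p - 1 - i) := by
    rw [← Finset.sum_add_distrib]
    exact Finset.sum_congr rfl (fun i _ => by ring)
  rw [h1, geom_sum₂_self]
  apply ge.add
  · apply ge_sum
    intro i _
    simpa using (ge.pow_sub ha hb (h.mono hn) i).mul (hb.pow (p - 1 - i))
  · have := mem_maximalIdeal_O.1 hr.1
    simpa using ge.mul this (hb.pow (p - 1))

lemma ext_O {σ τ : L ≃ₐ[K] L} (h : ∀ x, w.ge 0 x → σ x = τ x) : σ = τ := by
  ext x
  by_cases hx0 : x = 0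
  · simp [hx0]
  rcases le_total 0 (w.v x) with hx | hx
  · exact h x (Or.inr hx)
  · have := h x⁻¹ (Or.inr (by rw [v_inv hx0]; omega))
    rw [map_inv₀, map_inv₀] at this
    exact inv_injective this

lemma eq_zero_of_ge {x : L} (h : ∀ n, w.ge n x) : x = 0 := by
  by_contra hx
  have := (h (w.v x + 1)).le hx
  omega

lemma exists_prime_pow {p : ℕ} (hr : ResPerf w.O p) (j : ℕ) {z : L} (hz : w.ge 0 z) :
    ∃ y, w.ge 0 y ∧ w.ge 1 (z - y ^ (p ^ j)) := by
  induction j with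
  | zero => exact ⟨z, hz, by simpa using ge_zero 1⟩
  | succ j ih =>
    obtain ⟨y, hy, h⟩ := ih
    obtain ⟨b, hb⟩ := hr.2 ⟨y, hy⟩
    have hb' : w.ge 1 (y - (b : L) ^ p) := mem_maximalIdeal_O.1 hb
    refine ⟨b, b.2, ?_⟩
    have h2 := ge.pow_sub hy (ge.pow b.2 p) hb' (p ^ j)
    have h3 := h.add h2
    rw [pow_succ', pow_mul]
    simpa using h3

/-- In a discretely valued field with perfect residue field, the ramification number is computed
on the uniformizer. -/
lemma ge_of_uniformizer {p : ℕ} (hr : ResPerf w.O p) {σ : L ≃ₐ[K] L}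
    (hinv : ∀ x, w.v (σ x) = w.v x) (hσ : inInertia K w σ) {π : L} (hπ : π ≠ 0 ∧ w.v π = 1)
    {n : ℤ} (hn : w.ge n (σ π - π)) {z : L} (hz : w.ge 0 z) : w.ge n (σ z - z) := by
  have hge : ∀ {m : ℤ} {x : L}, w.ge m x → w.ge m (σ x) := by
    intro m x hx
    rcases hx with h | h
    · left; simp [h]
    · right; rwa [hinv]
  rcases le_total n 1 with h1 | h1
  · exact ge.mono (hσ z hz) h1
  obtain ⟨N, rfl⟩ : ∃ N : ℕ, n = N := ⟨n.toNat, by omega⟩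
  have hπO : w.ge 0 π := Or.inr (by omega)
  -- powers
  have hpw : ∀ (j : ℕ) (y : L), w.ge 0 y → w.ge (j + 1) (σ (y ^ (p ^ j)) - y ^ (p ^ j)) := by
    intro j
    induction j with
    | zero =>
      intro y hy
      have : w.ge 1 (σ y - y) := hσ y hy
      simpa using this
    | succ j ih =>
      intro y hy
      have := ge.sub_prime_pow hr (hge (hy.pow (p^j))) (hy.pow (p ^ j)) (ih y hy) (by omega)
      rw [pow_succ, pow_mul, map_pow]
      simpa using this
  have hmul : ∀ a b : L, w.ge 0 a → w.ge 0 b → w.ge N (σ a - a) → w.ge N (σ b - b) →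
      w.ge N (σ (a * b) - a * b) := by
    intro a b ha hb h2 h3
    have : σ (a * b) - a * b = σ a * (σ b - b) + (σ a - a) * b := by rw [map_mul]; ring
    rw [this]
    exact (by simpa using (hge ha).mul h3 : w.ge N (σ a * (σ b - b))).add (by simpa using h2.mul hb)
  have hpp : ∀ k : ℕ, w.ge N (σ (π ^ k) - π ^ k) := by
    intro k
    rw [map_pow]
    exact ge.pow_sub (hge hπO) hπO hn k
  have hap : ∀ k : ℕ, ∃ s c : L, w.ge 0 s ∧ w.ge N (σ s - s) ∧ w.ge 0 c ∧ z = s + π ^ k * c := by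
    intro k
    induction k with
    | zero => exact ⟨0, z, ge_zero 0, by simpa using ge_zero _, hz, by simp⟩
    | succ k ih =>
      obtain ⟨s, c, hs, hsS, hc, rfl⟩ := ih
      obtain ⟨y, hy, hyc⟩ := exists_prime_pow hr N hc
      refine ⟨s + π ^ k * y ^ (p ^ N), (c - y ^ (p ^ N)) * π⁻¹, ?_, ?_, ?_, ?_⟩
      · exact hs.add (by simpa using (hπO.pow k).mul (hy.pow _))
      · have h4 := hsS.add (hmul _ _ (hπO.pow k) (hy.pow (p ^ N)) (hpp k)
          ((hpw N y hy).mono (by omega)))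
        rw [map_add]
        convert h4 using 1
        ring
      · have := hyc.mul (ge_self (w := w) π⁻¹)
        rw [v_inv hπ.1, hπ.2] at this
        simpa using this
      · have := hπ.1
        field_simp
        ring
  obtain ⟨s, c, hs, hsS, hc, rfl⟩ := hap N
  have h5 : w.ge N (π ^ N * c) := by
    have := (ge_self (w := w) (π ^ N)).mul hc
    rw [v_pow hπ.1, hπ.2] at this
    simpa using this
  have := hsS.add ((hge h5).sub h5)
  rw [map_add]
  convert this using 1
  ring

/-- Tame automorphisms of order `p`. -/
lemma tame_eq_one {p : ℕ} (hp0 : (p : L) ≠ 0) (hpv : w.v (p : L) = 0) {σ : L ≃ₐ[K] L}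
    (hinv : ∀ x, w.v (σ x) = w.v x) (hσ : inInertia K w σ) {π : L} (hπ : π ≠ 0 ∧ w.v π = 1)
    (hn : w.ge 2 (σ π - π)) (hσp : σ ^ p = 1) : σ = 1 := by
  have hge : ∀ {m : ℤ} {x : L}, w.ge m x → w.ge m (σ x) := by
    intro m x hx
    rcases hx with h | h
    · left; simp [h]
    · right; rwa [hinv]
  have hπO : w.ge 0 π := Or.inr (by omega)
  by_contra hne
  obtain ⟨z, hz, hzne⟩ : ∃ z, w.ge 0 z ∧ σ z ≠ z := by
    by_contra hcon
    push Not at hcon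
    exact hne (ext_O (w := w) (fun x hx => hcon x hx))
  set y := σ z - z with hy
  have hy0 : y ≠ 0 := sub_ne_zero.2 hzne
  have hyO : w.ge 0 y := (hge hz).sub hz
  -- all elements of O satisfy the congruence
  have hpk : ∀ k : ℕ, w.ge (k + 1) (σ (π ^ k) - π ^ k) := by
    intro k
    induction k with
    | zero => simpa using ge_zero 1
    | succ k ih =>
      have : σ (π ^ (k+1)) - π ^ (k+1) = σ (π ^ k) * (σ π - π) + (σ (π ^ k) - π ^ k) * π := by
        rw [pow_succ, map_mul]; ring
      rw [this]
      apply ge.add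
      · have := (hge (ge_self (w := w) (π ^ k))).mul hn
        rw [v_pow hπ.1, hπ.2] at this
        refine this.mono ?_
        push_cast; omega
      · have := ih.mul (ge_self (w := w) π)
        rw [hπ.2] at this
        exact_mod_cast this
  have hyc : w.ge (w.v y + 1) (σ y - y) := by
    obtain ⟨k, hk⟩ : ∃ k : ℕ, w.v y = k := ⟨(w.v y).toNat, by have := hyO.le hy0; omega⟩
    have hu : w.ge 0 (y / π ^ k) := by
      right
      rw [v_div hy0 (pow_ne_zero _ hπ.1), v_pow hπ.1, hπ.2, hk]; simp
    have e1 : y = π ^ k * (y / π ^ k) := by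
      have := hπ.1
      field_simp
    have e2 : σ y - y = σ (π ^ k) * (σ (y / π ^ k) - (y / π ^ k)) +
        (σ (π ^ k) - π ^ k) * (y / π ^ k) := by
      conv_lhs => rw [e1, map_mul]
      ring
    rw [e2, hk]
    apply ge.add
    · have := (hge (ge_self (w := w) (π ^ k))).mul (hσ _ hu)
      rw [v_pow hπ.1, hπ.2] at this
      simpa using this
    · simpa using (hpk k).mul hu
  have hyi : ∀ i : ℕ, w.ge (w.v y + 1) ((σ ^ i) y - y) := by
    intro i
    induction i with
    | zero => simpa using ge_zero _
    | succ i ih =>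
      rw [pow_succ', AlgEquiv.mul_apply]
      have := (hge ih).add hyc
      simpa using this
  have hsum : ∑ i ∈ Finset.range p, (σ ^ i) y = 0 := by
    have : ∀ i ∈ Finset.range p, (σ ^ i) y = (σ ^ (i+1)) z - (σ ^ i) z := by
      intro i _
      rw [hy, map_sub, pow_succ, AlgEquiv.mul_apply]
    rw [Finset.sum_congr rfl this, Finset.sum_range_sub (fun i => (σ ^ i) z), hσp]
    simp
  have h3 := ge_sum (w := w) (Finset.range p) (fun i => (σ ^ i) y - y) (fun i _ => hyi i)
  rw [Finset.sum_sub_distrib, hsum] at h3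
  simp only [Finset.sum_const, Finset.card_range, nsmul_eq_mul, zero_sub] at h3
  have h4 := h3.neg
  rw [neg_neg] at h4
  have h5 := h4.le (mul_ne_zero hp0 hy0)
  rw [w.v_mul _ _ hp0 hy0, hpv] at h5
  omega

/-- `x` generates the valuation ring of `w` over the valuation ring of `u`. -/
def IsGen (u : DVal K) (w : DVal L) (x : L) : Prop :=
  w.ge 0 x ∧ ∀ y : L, w.ge 0 y → ∃ g : K[X], (∀ n, u.ge 0 (g.coeff n)) ∧ aeval x g = y

lemma ge_aeval_sub {u : DVal K} (hmap : ∀ c : K, u.ge 0 c → w.ge 0 (algebraMap K L c))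
    {n : ℤ} {a b : L} (ha : w.ge 0 a) (hb : w.ge 0 b)
    (h : w.ge n (a - b)) {g : K[X]} (hg : ∀ n, u.ge 0 (g.coeff n)) :
    w.ge n (aeval a g - aeval b g) := by
  rw [aeval_eq_sum_range, aeval_eq_sum_range, ← Finset.sum_sub_distrib]
  apply ge_sum
  intro i _
  rw [← smul_sub, Algebra.smul_def]
  simpa using (hmap _ (hg i)).mul (ge.pow_sub ha hb h i)

lemma IsGen.ge_sub {u : DVal K} (hmap : ∀ c : K, u.ge 0 c → w.ge 0 (algebraMap K L c))
    {x : L} (hx : IsGen u w x) {σ : L ≃ₐ[K] L} (hinv : ∀ x, w.v (σ x) = w.v x)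
    {n : ℤ} (h : w.ge n (σ x - x)) {z : L} (hz : w.ge 0 z) : w.ge n (σ z - z) := by
  obtain ⟨g, hg, rfl⟩ := hx.2 z hz
  rw [← aeval_algHom_apply]
  refine ge_aeval_sub hmap ?_ hx.1 h hg
  rcases hx.1 with h | h
  · left; simp [h]
  · right; rwa [hinv]

lemma IsGen.ramNum {u : DVal K} (hmap : ∀ c : K, u.ge 0 c → w.ge 0 (algebraMap K L c))
    {x : L} (hx : IsGen u w x) {p : ℕ} (hr : ResPerf w.O p)
    {σ : L ≃ₐ[K] L} (hinv : ∀ x, w.v (σ x) = w.v x)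
    {π : L} (hπ : π ≠ 0 ∧ w.v π = 1) (hσ : σ ≠ 1) :
    σ x - x ≠ 0 ∧ ramNum K w π σ + 1 = w.v (σ x - x) ∧ 0 ≤ w.v (σ x - x) := by
  have hne : σ x - x ≠ 0 := by
    intro h0
    apply hσ
    apply ext_O (w := w)
    intro z hz
    have := eq_zero_of_ge (w := w) (fun n => hx.ge_sub hmap hinv (n := n) (by rw [h0]; exact ge_zero n) hz)
    simpa [sub_eq_zero] using this
  have hge : ∀ {m : ℤ} {x : L}, w.ge m x → w.ge m (σ x) := by
    intro m x hx
    rcases hx with h | h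
    · left; simp [h]
    · right; rwa [hinv]
  have h0 := ((hge hx.1).sub hx.1).le hne
  refine ⟨hne, ?_, h0⟩
  unfold _root_.ramNum
  by_cases hi : inInertia K w σ
  · simp only [hi, if_true]
    rw [sub_add_cancel]
    have hπne : σ π - π ≠ 0 := by
      intro h0
      exact hne (eq_zero_of_ge (w := w)
        (fun n => ge_of_uniformizer hr hinv hi hπ (n := n) (by rw [h0]; exact ge_zero n) hx.1))
    apply le_antisymm
    · exact (ge_of_uniformizer hr hinv hi hπ (ge_self _) hx.1).le hne
    · exact (hx.ge_sub hmap hinv (ge_self _) (Or.inr (by omega))).le hπne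
  · simp only [hi, if_false]
    by_contra h1
    apply hi
    intro z hz
    exact hx.ge_sub hmap hinv (n := 1) (Or.inr (by omega)) hz

end
end DVal


namespace DVal

open IsLocalRing Polynomial

section
variable {M : Type*} [Field M] {W : DVal M}

lemma lift_O {Q : M[X]} (hQ : ∀ n, W.ge 0 (Q.coeff n)) : ∃ Q' : W.O[X], Q'.map W.O.subtype = Q := by
  have : Q ∈ lifts W.O.subtype := by
    rw [lifts_iff_coeff_lifts]
    intro n
    exact ⟨⟨_, hQ n⟩, rfl⟩
  exact (mem_lifts _).1 this

lemma eval_lift_O (Q' : W.O[X]) (a : W.O) :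
    ((Q'.eval a : W.O) : M) = (Q'.map W.O.subtype).eval (a : M) :=
  (eval_map_apply (f := W.O.subtype) (p := Q') a).symm

lemma ge_of_roots {ι : Type*} (s : Finset ι) (a : ι → M) (hinj : Set.InjOn a s)
    (ha : ∀ i, W.ge 0 (a i)) {Q : M[X]} (hQ : ∀ n, W.ge 0 (Q.coeff n))
    (hr : ∀ i ∈ s, Q.eval (a i) = 0) {b : M} (hb : W.ge 0 b) :
    ∃ r, W.ge 0 r ∧ Q.eval b = (∏ i ∈ s, (b - a i)) * r := by
  classical
  obtain ⟨Q', rfl⟩ := lift_O hQ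
  let a' : ι → W.O := fun i => ⟨a i, ha i⟩
  by_cases h0 : Q' = 0
  · exact ⟨0, ge_zero 0, by simp [h0]⟩
  have hroot : ∀ i ∈ s, Q'.eval (a' i) = 0 := by
    intro i hi
    apply Subtype.ext
    rw [eval_lift_O]; exact hr i hi
  have hdvd : ((s.val.map a').map (fun c => X - C c)).prod ∣ Q' := by
    rw [Multiset.prod_X_sub_C_dvd_iff_le_roots h0, Multiset.le_iff_subset]
    · intro c hc
      obtain ⟨i, hi, rfl⟩ := Multiset.mem_map.1 hc
      exact (mem_roots h0).2 (hroot i hi)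
    · refine Multiset.Nodup.map_on ?_ s.nodup
      intro i hi j hj hij
      exact hinj hi hj (congrArg Subtype.val hij)
  obtain ⟨R, hR⟩ := hdvd
  refine ⟨((R.eval ⟨b, hb⟩ : W.O) : M), (R.eval ⟨b, hb⟩ : W.O).2, ?_⟩
  have h1 := congrArg (fun q : W.O[X] => ((q.eval ⟨b, hb⟩ : W.O) : M)) hR
  simp only [eval_mul, eval_lift_O Q'] at h1
  rw [h1, Multiset.map_map]
  have : ((s.val.map ((fun c => X - C c) ∘ a')).prod : W.O[X]) = ∏ i ∈ s, (X - C (a' i)) := rfl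
  rw [this, eval_prod]
  simp [a']

lemma ge_coeff_prod {ι : Type*} (s : Finset ι) (a : ι → M)
    (ha : ∀ i, W.ge 0 (a i)) (n : ℕ) : W.ge 0 ((∏ i ∈ s, (X - C (a i))).coeff n) := by
  let a' : ι → W.O := fun i => ⟨a i, ha i⟩
  have : ∏ i ∈ s, (X - C (a i)) = (∏ i ∈ s, (X - C (a' i))).map W.O.subtype := by
    simp [Polynomial.map_prod, a']
  rw [this, coeff_map]
  exact ((∏ i ∈ s, (X - C (a' i))).coeff n).2

lemma exists_charpoly {L : Type*} [Field L] [Algebra L M] [FiniteDimensional L M] [IsGalois L M]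
    {w : DVal L} {d : ℕ} (hwW : Ext w W d) {x : M} (hx : W.ge 0 x) :
    ∃ P : L[X], P.map (algebraMap L M) = ∏ h : M ≃ₐ[L] M, (X - C (h x)) ∧
      (∀ n, w.ge 0 (P.coeff n)) ∧ aeval x P = 0 := by
  obtain ⟨P, hP⟩ := (mem_lifts _).1
      (Algebra.IsInvariant.charpoly_mem_lifts L M (M ≃ₐ[L] M) x)
  have hPe : P.map (algebraMap L M) = ∏ h : M ≃ₐ[L] M, (X - C (h x)) := hP
  refine ⟨P, hPe, fun n => ?_, ?_⟩
  · refine (hwW.ge_map (x := P.coeff n)).1 ?_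
    have h1 := ge_coeff_prod (W := W) Finset.univ (fun h : M ≃ₐ[L] M => h x)
      (fun h => (hwW.inv_ge h).2 hx) n
    rw [← hPe, coeff_map] at h1
    exact h1
  · rw [← eval_map_algebraMap, hPe, eval_prod]
    exact Finset.prod_eq_zero (Finset.mem_univ 1) (by simp)

variable {K : Type*} [Field K] [Algebra K M] [FiniteDimensional K M] [IsGalois K M]
  {L : IntermediateField K M} [IsGalois K L]
  {u : DVal K} {w : DVal L} {e e' d : ℕ}

/-- Herbrand's formula. -/
theorem herbrand (huw : Ext u w e) (huW : Ext u W e') (hwW : Ext w W d)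
    {x : M} (hx : IsGen u W x) {y : L} (hy : IsGen u w y) {σ : L ≃ₐ[K] L} (hσ : σ y - y ≠ 0)
    (hxne : ∀ g : M ≃ₐ[K] M, g ≠ 1 → g x - x ≠ 0) [DecidableEq (L ≃ₐ[K] L)] :
    d * w.v (σ y - y) =
      ∑ g ∈ Finset.univ.filter (fun g : M ≃ₐ[K] M => AlgEquiv.restrictNormalHom L g = σ),
        W.v (g x - x) := by
  classical
  set s := Finset.univ.filter (fun g : M ≃ₐ[K] M => AlgEquiv.restrictNormalHom L g = σ) with hs
  have hσ1 : σ ≠ 1 := by rintro rfl; simp at hσ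
  have hgx : ∀ g : M ≃ₐ[K] M, W.ge 0 (g x) := fun g => (huW.inv_ge g).2 hx.1
  have hsne : ∀ g ∈ s, g x - x ≠ 0 := by
    intro g hg
    apply hxne
    rintro rfl
    rw [hs, Finset.mem_filter, map_one] at hg
    exact hσ1 hg.2.symm
  have hmap : ∀ c : K, u.ge 0 c → w.ge 0 (algebraMap K L c) := fun c hc => huw.ge_map.2 hc
  have hcomm : ∀ (g : M ≃ₐ[K] M) (z : L), ((AlgEquiv.restrictNormalHom L g z : L) : M) = g z :=
    fun g z => AlgEquiv.restrictNormal_commutes g L z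
  have hprod : ∏ g ∈ s, (x - g x) ≠ 0 := by
    rw [Finset.prod_ne_zero_iff]
    intro g hg h0
    apply hsne g hg
    linear_combination -h0
  have hvprod : W.v (∏ g ∈ s, (x - g x)) = ∑ g ∈ s, W.v (g x - x) := by
    rw [v_prod]
    · exact Finset.sum_congr rfl (fun g _ => v_sub_comm _ _)
    · exact fun g hg => Finset.prod_ne_zero_iff.1 hprod g hg
  rw [← hvprod]
  apply le_antisymm
  · obtain ⟨g₀, hg₀⟩ := AlgEquiv.restrictNormalHom_surjective (F := K) (K₁ := L) M σ
    obtain ⟨P, hPe, hPc, hP0⟩ := exists_charpoly hwW hx.1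
    have hPσ : aeval x (P.map (σ : L →+* L)) = ∏ g ∈ s, (x - g x) := by
      have h1 : (P.map (σ : L →+* L)).map (algebraMap L M) =
          (P.map (algebraMap L M)).map (g₀ : M →+* M) := by
        rw [Polynomial.map_map, Polynomial.map_map]
        congr 1
        ext z
        simp only [RingHom.comp_apply]
        have := hcomm g₀ z
        rw [hg₀] at this
        exact this
      rw [← eval_map_algebraMap, h1, hPe, Polynomial.map_prod, eval_prod]
      refine Finset.prod_bij (fun h _ => g₀ * h.restrictScalars K) ?_ ?_ ?_ ?_
      · intro h _
        rw [hs, Finset.mem_filter, map_mul, hg₀]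
        refine ⟨Finset.mem_univ _, ?_⟩
        have : AlgEquiv.restrictNormalHom L (h.restrictScalars K) = 1 := by
          ext z
          rw [hcomm]
          exact h.commutes z
        rw [this, mul_one]
      · intro h _ h' _ hh
        have := mul_left_cancel hh
        ext z
        exact DFunLike.congr_fun this z
      · intro g hg
        rw [hs, Finset.mem_filter] at hg
        have h2 : AlgEquiv.restrictNormalHom L (g₀⁻¹ * g) = 1 := by
          rw [map_mul, map_inv, hg₀, hg.2, inv_mul_cancel]
        refine ⟨AlgEquiv.ofRingEquiv (f := ((g₀⁻¹ * g : M ≃ₐ[K] M) : M ≃+* M)) ?_, Finset.mem_univ _, ?_⟩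
        · intro z
          have := hcomm (g₀⁻¹ * g) z
          rw [h2] at this
          exact this.symm
        · ext z
          change g₀ (g₀⁻¹ (g z)) = g z
          rw [← AlgEquiv.mul_apply]; simp
      · intro h _
        simp
    have key : W.ge (d * w.v (σ y - y)) (aeval x (P.map (σ : L →+* L) - P)) := by
      rw [aeval_eq_sum_range]
      apply ge_sum
      intro i _
      rw [Algebra.smul_def, coeff_sub, coeff_map]
      have h3 := hy.ge_sub hmap (huw.inv σ) (ge_self _) (hPc i)
      have h4 : W.ge (d * w.v (σ y - y)) (algebraMap L M (σ (P.coeff i) - P.coeff i)) := by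
        by_cases h0 : σ (P.coeff i) - P.coeff i = 0
        · left; rw [h0, map_zero]
        · right
          rw [hwW.map _ h0]
          exact mul_le_mul_of_nonneg_left (h3.le h0) (by positivity)
      simpa using h4.mul (hx.1.pow i)
    rw [map_sub, hP0, sub_zero, hPσ] at key
    exact key.le hprod
  · have hyM : W.ge 0 (algebraMap L M y) := hwW.ge_map.2 hy.1
    have hσyM : W.ge 0 (algebraMap L M (σ y)) := hwW.ge_map.2 ((huw.inv_ge σ).2 hy.1)
    obtain ⟨g, hg, hgy⟩ := hx.2 _ hyM
    have hgc : ∀ n, W.ge 0 ((g.map (algebraMap K M) - C (algebraMap L M (σ y))).coeff n) := by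
      intro n
      rw [coeff_sub, coeff_map, coeff_C]
      refine (huW.ge_map.2 (hg n)).sub ?_
      split_ifs
      · exact hσyM
      · exact ge_zero 0
    obtain ⟨r, hr, hre⟩ := ge_of_roots s (fun τ => τ x) (by
        intro τ _ τ' _ h
        by_contra hne
        have h5 : τ'⁻¹ * τ ≠ 1 := fun h6 => hne (by rw [inv_mul_eq_one] at h6; exact h6.symm)
        apply hxne _ h5
        have h' : τ x = τ' x := h
        rw [AlgEquiv.mul_apply, h', ← AlgEquiv.mul_apply, inv_mul_cancel]
        simp) hgx hgc (by
        intro τ hτ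
        rw [hs, Finset.mem_filter] at hτ
        rw [eval_sub, eval_C, eval_map_algebraMap, aeval_algHom_apply, hgy, ← hτ.2]
        exact sub_eq_zero.2 (hcomm τ y).symm) hx.1
    rw [eval_sub, eval_C, eval_map_algebraMap, hgy, ← map_sub] at hre
    have hne : y - σ y ≠ 0 := fun h => hσ (by linear_combination -h)
    have hneM : algebraMap L M (y - σ y) ≠ 0 := (_root_.map_ne_zero _).2 hne
    have hr0 : r ≠ 0 := by rintro rfl; rw [mul_zero] at hre; exact hneM hre
    have h7 := congrArg W.v hre
    rw [W.v_mul _ _ hprod hr0, hwW.map _ hne, v_sub_comm] at h7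
    have := hr.le hr0
    omega

end
end DVal


namespace DVal

open IsLocalRing Polynomial

lemma monic_root_ge {E : Type*} [Field E] {w : DVal E} {Q : E[X]} (hm : Q.Monic)
    (hQ : ∀ n, w.ge 0 (Q.coeff n)) {x : E} (hx : Q.eval x = 0) : w.ge 0 x := by
  obtain ⟨Q', rfl⟩ := lift_O hQ
  have hm' : Q'.Monic := (Function.Injective.monic_map_iff (f := w.O.subtype)
    Subtype.val_injective).2 hm
  have : IsIntegral w.O x := ⟨Q', hm', by rw [eval_map] at hx; exact hx⟩
  obtain ⟨y, rfl⟩ := IsIntegrallyClosed.isIntegral_iff.1 this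
  exact y.2

section
variable {M : Type*} [Field M] {W : DVal M}
variable {K : Type*} [Field K] [Algebra K M] [FiniteDimensional K M] [IsGalois K M]
  {u : DVal K}

lemma Ext.trans {L : IntermediateField K M} [IsGalois K L] {w : DVal L} {e d : ℕ}
    (huw : Ext u w e) (hwW : Ext w W d) : Ext u W (d * e) := by
  have hcomm : ∀ (g : M ≃ₐ[K] M) (z : L), ((AlgEquiv.restrictNormalHom L g z : L) : M) = g z :=
    fun g z => AlgEquiv.restrictNormal_commutes g L z
  constructor
  · intro x hx
    rw [IsScalarTower.algebraMap_apply K L M, hwW.map _ ((_root_.map_ne_zero _).2 hx),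
      huw.map _ hx]
    push_cast; ring
  · intro g x
    by_cases hx : x = 0
    · simp [hx]
    have hnorm := Algebra.norm_eq_prod_automorphisms L x
    have hN0 : Algebra.norm L x ≠ 0 := by simpa [Algebra.norm_eq_zero_iff] using hx
    have h1 : W.v (g (algebraMap L M (Algebra.norm L x))) =
        W.v (algebraMap L M (Algebra.norm L x)) := by
      have := hcomm g (Algebra.norm L x)
      rw [show algebraMap L M (Algebra.norm L x) = ((Algebra.norm L x : L) : M) from rfl, ← this]
      have h2 := hwW.map _ hN0
      have h3 := hwW.map (AlgEquiv.restrictNormalHom L g (Algebra.norm L x)) (by simpa using hN0)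
      rw [huw.inv] at h3
      exact h3.trans h2.symm
    have h2 : ∀ h : M ≃ₐ[L] M, W.v (g (h x)) = W.v (g x) := by
      intro h
      have h4 : ∀ z : L, (g * h.restrictScalars K * g⁻¹) (algebraMap L M z) = algebraMap L M z := by
        intro z
        have h5 := hcomm g⁻¹ z
        rw [AlgEquiv.mul_apply, AlgEquiv.mul_apply,
          show algebraMap L M z = (z : M) from rfl, ← h5]
        have h6 : (h.restrictScalars K) ((AlgEquiv.restrictNormalHom L g⁻¹ z : L) : M) =
            ((AlgEquiv.restrictNormalHom L g⁻¹ z : L) : M) := h.commutes _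
        rw [h6, h5, ← AlgEquiv.mul_apply]
        simp
      let k : M ≃ₐ[L] M := AlgEquiv.ofRingEquiv
        (f := ((g * h.restrictScalars K * g⁻¹ : M ≃ₐ[K] M) : M ≃+* M)) h4
      have h7 := hwW.inv k (g x)
      have h8 : k (g x) = g (h x) := by
        change g (h (g⁻¹ (g x))) = _
        rw [← AlgEquiv.mul_apply g⁻¹]; simp
      rw [← h8, h7]
    rw [hnorm, map_prod, v_prod _ _ (by intro i _; simpa using hx),
      v_prod _ _ (by intro i _; simpa using hx)] at h1
    simp only [h2, hwW.inv, Finset.sum_const, nsmul_eq_mul] at h1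
    have hc : ((Finset.univ : Finset (M ≃ₐ[L] M)).card : ℤ) ≠ 0 := by
      simp
    exact mul_left_cancel₀ hc h1

lemma Ext.descend {E : IntermediateField K M} [IsGalois K E] {w : DVal E} {e' q : ℕ}
    (huW : Ext u W e') (hq : 0 < q)
    (hw : ∀ x : K, x ≠ 0 → w.v (algebraMap K E x) = q * u.v x) :
    ∃ d, 0 < d ∧ Ext w W d ∧ Ext u w q ∧ e' = d * q := by
  have hcomm : ∀ (g : M ≃ₐ[K] M) (z : E), ((AlgEquiv.restrictNormalHom E g z : E) : M) = g z :=
    fun g z => AlgEquiv.restrictNormal_commutes g E z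
  have hmap : ∀ c : K, u.ge 0 c → w.ge 0 (algebraMap K E c) := by
    intro c hc
    by_cases h0 : c = 0
    · left; simp [h0]
    · right; rw [hw c h0]
      exact mul_nonneg (by positivity) (hc.le h0)
  have hintegral : ∀ x : E, W.ge 0 (x : M) → w.ge 0 x := by
    intro x hx
    obtain ⟨P, hPe, hPc, hP0⟩ := exists_charpoly huW hx
    have hPm : P.Monic := by
      rw [(Function.Injective.monic_map_iff (f := algebraMap K M) (algebraMap K M).injective),
        hPe]
      exact monic_prod_of_monic _ _ (fun _ _ ↦ monic_X_sub_C _)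
    refine monic_root_ge (Q := P.map (algebraMap K E)) (hPm.map _) ?_ ?_
    · intro n; rw [coeff_map]; exact hmap _ (hPc n)
    · apply (algebraMap E M).injective
      rw [eval_map_algebraMap, map_zero, ← aeval_algebraMap_apply]
      exact hP0
  have hintegral' : ∀ x : E, x ≠ 0 → 0 ≤ W.v (x : M) → 0 ≤ w.v x := by
    intro x hx h
    exact (hintegral x (Or.inr h)).le hx
  obtain ⟨π, hπ0, hπ1⟩ := w.exists_uniformizer
  have hc0 : ∀ x : E, x ≠ 0 → (x : M) ≠ 0 := fun x hx => by simpa using hx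
  have hd : 0 < W.v (π : M) := by
    by_contra h
    have := hintegral' π⁻¹ (inv_ne_zero hπ0) (by
      rw [IntermediateField.coe_inv, v_inv (hc0 _ hπ0)]; omega)
    rw [v_inv hπ0] at this
    omega
  obtain ⟨d, hdd⟩ : ∃ d : ℕ, W.v (π : M) = d := ⟨(W.v (π : M)).toNat, by omega⟩
  have hunit0 : ∀ x : E, x ≠ 0 → w.v x = 0 → W.v (x : M) ≤ 0 := by
    intro x hx hx0
    by_contra hpos
    push Not at hpos
    have h1 : x ^ d * π ^ (-(W.v (x : M))) ≠ 0 :=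
      mul_ne_zero (pow_ne_zero _ hx) (zpow_ne_zero _ hπ0)
    have h2 := hintegral' _ h1 (by
      rw [IntermediateField.coe_mul, W.v_mul _ _ (hc0 _ (pow_ne_zero _ hx))
        (hc0 _ (zpow_ne_zero _ hπ0)), IntermediateField.coe_pow]
      have e3 : (((π ^ (-(W.v (x : M))) : E)) : M) = (π : M) ^ (-(W.v (x : M))) :=
        map_zpow₀ (algebraMap E M) π _
      rw [e3, v_pow (hc0 _ hx), v_zpow (hc0 _ hπ0), hdd]
      apply le_of_eq
      ring)
    rw [w.v_mul _ _ (pow_ne_zero _ hx) (zpow_ne_zero _ hπ0), v_pow hx, v_zpow hπ0, hx0, hπ1] at h2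
    omega
  have hunit : ∀ x : E, x ≠ 0 → w.v x = 0 → W.v (x : M) = 0 := by
    intro x hx hx0
    have h1 := hunit0 x hx hx0
    have h2 := hunit0 x⁻¹ (inv_ne_zero hx) (by rw [v_inv hx, hx0]; rfl)
    rw [IntermediateField.coe_inv, v_inv (hc0 _ hx)] at h2
    omega
  have hwW : ∀ x : E, x ≠ 0 → W.v (algebraMap E M x) = d * w.v x := by
    intro x hx
    have hz := zpow_ne_zero (w.v x) hπ0
    have h1 := hunit (x / π ^ (w.v x)) (div_ne_zero hx hz)
      (by rw [v_div hx hz, v_zpow hπ0, hπ1]; ring)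
    have e3 : (((π ^ (w.v x) : E)) : M) = (π : M) ^ (w.v x) :=
        map_zpow₀ (algebraMap E M) π _
    rw [IntermediateField.coe_div, e3, v_div (hc0 _ hx) (zpow_ne_zero _ (hc0 _ hπ0)),
      v_zpow (hc0 _ hπ0), hdd] at h1
    change W.v (x : M) = _
    linarith [mul_comm (w.v x) (d : ℤ)]
  have hd0 : 0 < d := by omega
  refine ⟨d, hd0, ⟨hwW, fun σ x => huW.inv (σ.restrictScalars K) x⟩, ⟨hw, ?_⟩, ?_⟩
  · intro σ x
    by_cases hx : x = 0
    · simp [hx]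
    obtain ⟨g, rfl⟩ := AlgEquiv.restrictNormalHom_surjective (F := K) (K₁ := E) M σ
    have h1 := hwW _ ((_root_.map_ne_zero (AlgEquiv.restrictNormalHom E g)).2 hx)
    have h2 := hcomm g x
    change W.v _ = _ at h1
    rw [show algebraMap E M (AlgEquiv.restrictNormalHom E g x) = g x from h2, huW.inv] at h1
    have h3 := hwW x hx
    rw [show (algebraMap E M x) = (x : M) from rfl, h1] at h3
    exact mul_left_cancel₀ (by exact_mod_cast hd0.ne') h3
  · obtain ⟨ϖ, h0, h1⟩ := u.exists_uniformizer
    have h2 := huW.map ϖ h0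
    rw [IsScalarTower.algebraMap_apply K E M, hwW _ ((_root_.map_ne_zero _).2 h0), hw _ h0, h1] at h2
    have : (e' : ℤ) = d * q := by linarith
    exact_mod_cast this

end
end DVal


namespace DVal

open IsLocalRing Polynomial MeasureTheory

lemma integral_ind (x a : ℝ) (hx : 0 ≤ x) :
    IntervalIntegrable (fun t : ℝ => if t ≤ a then (1:ℝ) else 0) volume 0 x ∧
    ∫ t in (0:ℝ)..x, (if t ≤ a then (1:ℝ) else 0) = max (min x a) 0 := by
  have h1 : (fun t : ℝ => if t ≤ a then (1:ℝ) else 0) = Set.indicator (Set.Iic a) 1 := by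
    ext t; simp [Set.indicator_apply]
  rw [h1]
  constructor
  · have h2 : IntervalIntegrable (fun _ : ℝ => (1:ℝ)) volume 0 x := intervalIntegrable_const
    rw [intervalIntegrable_iff] at h2 ⊢
    exact Integrable.indicator h2 measurableSet_Iic
  · rw [intervalIntegral.integral_of_le hx, setIntegral_indicator measurableSet_Iic,
      Set.Ioc_inter_Iic]
    simp [min_comm]

section
variable {K L : Type*} [Field K] [Field L] [Algebra K L] [FiniteDimensional K L]
  {w : DVal L}

open Classical in
lemma hherb_formula (π : L) (x : ℝ) (hx : 0 ≤ x) :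
    hherb K w π x = (x + ∑ σ ∈ (Finset.univ : Finset (L ≃ₐ[K] L)).erase 1,
      max (min x (ramNum K w π σ)) 0) / (Nat.card ↥(lowerSet K w π 0) : ℝ) := by
  unfold hherb
  rw [intervalIntegral.integral_div]
  congr 1
  have h1 : ∀ t : ℝ, (Nat.card ↥(lowerSet K w π t) : ℝ) =
      1 + ∑ σ ∈ (Finset.univ : Finset (L ≃ₐ[K] L)).erase 1,
        if t ≤ (ramNum K w π σ : ℝ) then (1:ℝ) else 0 := by
    intro t
    have h2 : lowerSet K w π t = ((Finset.univ.filter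
      (fun σ : L ≃ₐ[K] L => σ = 1 ∨ t ≤ (ramNum K w π σ : ℝ)) : Finset _) : Set (L ≃ₐ[K] L)) := by
      ext σ; simp [lowerSet]
    rw [h2, Nat.card_coe_set_eq, Set.ncard_coe_finset, Finset.card_filter,
      ← Finset.add_sum_erase _ _ (Finset.mem_univ (1 : L ≃ₐ[K] L))]
    push_cast
    simp only [true_or, if_true]
    congr 1
    apply Finset.sum_congr rfl
    intro σ hσ
    simp [Finset.ne_of_mem_erase hσ]
  simp only [h1]
  rw [intervalIntegral.integral_add, intervalIntegral.integral_finset_sum]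
  · congr 1
    · simp
    · exact Finset.sum_congr rfl (fun σ _ => (integral_ind x _ hx).2)
  · intro σ _; exact (integral_ind x _ hx).1
  · exact intervalIntegrable_const
  · have := IntervalIntegrable.sum (μ := volume) (a := 0) (b := x)
      ((Finset.univ : Finset (L ≃ₐ[K] L)).erase 1)
      (f := fun σ t => if t ≤ (ramNum K w π σ : ℝ) then (1:ℝ) else 0)
      (fun σ _ => (integral_ind x _ hx).1)
    rw [Finset.sum_fn] at this
    exact this

variable [IsGalois K L] {u : DVal K} {e : ℕ}

open Classical in
lemma hherb_wild (huw : Ext u w e) {p : ℕ} (hp : p.Prime) (hr : ResPerf u.O p) {π : L}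
    (hπ : π ≠ 0 ∧ w.v π = 1) {y : L} (hy : IsGen u w y) (n : ℕ) :
    (e : ℝ) * (hherb K w π n + 1) = ((n + 1 + ∑ σ ∈ (Finset.univ : Finset (L ≃ₐ[K] L)).erase 1,
      min (n + 1 : ℤ) (w.v (σ y - y)) : ℤ) : ℝ) := by
  obtain ⟨hrw, hcard, -⟩ := huw.main.2 p hp hr
  have hR : ∀ σ : L ≃ₐ[K] L, σ ≠ 1 → σ y - y ≠ 0 ∧ ramNum K w π σ + 1 = w.v (σ y - y) ∧
      0 ≤ w.v (σ y - y) := fun σ hσ =>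
    hy.ramNum (fun c hc => huw.ge_map.2 hc) hrw (huw.inv σ) hπ hσ
  have hin : ∀ σ : L ≃ₐ[K] L, σ ≠ 1 → (inInertia K w σ ↔ 1 ≤ w.v (σ y - y)) := by
    intro σ hσ
    constructor
    · intro h; exact ge.le (w := w) (h y hy.1) (hR σ hσ).1
    · intro h z hz
      exact hy.ge_sub (fun c hc => huw.ge_map.2 hc) (huw.inv σ) (n := 1) (Or.inr h) hz
  have hlow : Nat.card ↥(lowerSet K w π 0) = e := by
    rw [← hcard]
    apply Nat.card_congr
    refine Equiv.subtypeEquivRight (fun σ => ?_)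
    change (σ = 1 ∨ (0:ℝ) ≤ (ramNum K w π σ : ℝ)) ↔ _
    by_cases h1 : σ = 1
    · subst h1
      simp only [true_or, true_iff]
      intro z _; left; simp
    · rw [hin σ h1]
      have := (hR σ h1).2.1
      simp only [h1, false_or]
      rw [← Int.cast_zero, Int.cast_le]
      omega
  have hsum : (e : ℤ) = 1 + ∑ σ ∈ (Finset.univ : Finset (L ≃ₐ[K] L)).erase 1,
      if 1 ≤ w.v (σ y - y) then (1:ℤ) else 0 := by
    rw [← hcard, Nat.card_eq_fintype_card, Fintype.card_subtype, Finset.card_filter,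
      ← Finset.add_sum_erase _ _ (Finset.mem_univ (1 : L ≃ₐ[K] L))]
    push_cast
    congr 1
    · rw [if_pos]; intro z _; left; simp
    · apply Finset.sum_congr rfl
      intro σ hσ
      simp only [hin σ (Finset.ne_of_mem_erase hσ)]
  have he : (e : ℝ) ≠ 0 := by exact_mod_cast huw.pos.ne'
  rw [hherb_formula π n (by positivity), hlow, mul_add, mul_div_cancel₀ _ he, mul_one]
  have hsumR : (e : ℝ) = 1 + ∑ σ ∈ (Finset.univ : Finset (L ≃ₐ[K] L)).erase 1,
      if 1 ≤ w.v (σ y - y) then (1:ℝ) else 0 := by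
    have := congrArg (Int.cast : ℤ → ℝ) hsum
    push_cast at this
    exact this
  rw [hsumR]
  push_cast
  rw [add_add_add_comm, ← Finset.sum_add_distrib]
  congr 1
  apply Finset.sum_congr rfl
  intro σ hσ
  obtain ⟨-, h1, h2⟩ := hR σ (Finset.ne_of_mem_erase hσ)
  have h3 : (ramNum K w π σ : ℝ) = (w.v (σ y - y) : ℝ) - 1 := by
    rw [← h1]; push_cast; ring
  rw [h3]
  split_ifs with h4
  · have : (1:ℝ) ≤ (w.v (σ y - y) : ℝ) := by exact_mod_cast h4
    rw [max_eq_left (le_min (by positivity) (by linarith)), ← min_add_add_right]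
    simp
  · have h5 : w.v (σ y - y) = 0 := by omega
    rw [h5]
    have : (0:ℝ) ≤ n := by positivity
    rw [max_eq_right (by simp), min_eq_right (by push_cast; linarith)]
    simp

end
end DVal


section comb

variable {G A B : Type*} [Group G] [Group A] [Group B] [Fintype G] [Fintype A] [Fintype B]
  [DecidableEq G] [DecidableEq A] [DecidableEq B]

lemma fiber_sum (φ : G →* A) (g : G) (Φ : G → ℤ) :
    ∑ k ∈ Finset.univ.filter (fun k => φ k = φ g), Φ k =
      ∑ h ∈ Finset.univ.filter (fun k => φ k = 1), Φ (g * h) := by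
  symm
  refine Finset.sum_bij' (fun h _ => g * h) (fun k _ => g⁻¹ * k) ?_ ?_ ?_ ?_ ?_ <;> simp +contextual

lemma isosceles {F : G → ℤ} (hF : ∀ g h, min (F g) (F h) ≤ F (g * h)) (hinv : ∀ g, F g⁻¹ = F g)
    {g h : G} (hle : F (g * h) ≤ F g) : F (g * h) = min (F g) (F h) := by
  apply le_antisymm _ (hF g h)
  refine le_min hle ?_
  have := hF g⁻¹ (g * h)
  rw [hinv, min_eq_right hle] at this
  simpa using this

lemma F_pow {F : G → ℤ} (hF : ∀ g h, min (F g) (F h) ≤ F (g * h)) (h1 : ∀ g, F g ≤ F 1)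
    (g : G) (k : ℕ) : F g ≤ F (g ^ k) := by
  induction k with
  | zero => simpa using h1 g
  | succ k ih =>
    rw [pow_succ]
    exact (le_min ih le_rfl).trans (hF _ _)

lemma exists_pow_of_prime {p : ℕ} (hp : p.Prime) {C : Type*} [Group C]
    (hC : Nat.card C = p) {a b : C} (ha : a ≠ 1) : ∃ k : ℕ, a ^ k = b := by
  have : Fact p.Prime := ⟨hp⟩
  have hfin : Finite C := Nat.finite_of_card_ne_zero (by rw [hC]; exact hp.ne_zero)
  have h := mem_zpowers_of_prime_card (G := C) (g := a) (g' := b) hC ha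
  rw [← mem_powers_iff_mem_zpowers] at h
  exact h

theorem comb_core (p : ℕ) (hp : p.Prime) (φ : G →* A) (ψ : G →* B)
    (hφ : Function.Surjective φ) (hψ : Function.Surjective ψ)
    (hB : Nat.card B = p) (hH : Nat.card φ.ker = p) (hinj : ∀ g, φ g = 1 → ψ g = 1 → g = 1)
    (F : G → ℤ) (hF : ∀ g h, min (F g) (F h) ≤ F (g * h)) (hinv : ∀ g, F g⁻¹ = F g)
    (h1 : ∀ g, F g ≤ F 1)
    (D : ℤ) (hD : ∀ σ : B, σ ≠ 1 → ∑ g ∈ Finset.univ.filter (fun g => ψ g = σ), F g = D)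
    (r : ℕ) (f : A → ℤ)
    (hf : ∀ τ : A, τ ≠ 1 → r * f τ = ∑ g ∈ Finset.univ.filter (fun g => φ g = τ), F g) :
    ∃ m c : ℤ, c ≤ m ∧ (∀ h, φ h = 1 → h ≠ 1 → F h = c) ∧
      (∀ x : ℤ, r * x = m + (p - 1) * c →
        p * D = r * (x + ∑ τ ∈ Finset.univ.erase 1, min x (f τ))) ∧
      (c < m → ∃ τ : A, τ ≠ 1 ∧ r * f τ = m + (p - 1) * c) := by
  have hp2 := hp.two_le
  -- the constant c
  have : Nontrivial φ.ker := by
    apply Finite.one_lt_card_iff_nontrivial.1; omega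
  obtain ⟨⟨h₀, hh₀⟩, hne₀⟩ := exists_ne (1 : φ.ker)
  have hle : ∀ a b, φ a = 1 → φ b = 1 → a ≠ 1 → F a ≤ F b := by
    intro a b ha hb ha1
    obtain ⟨k, hk⟩ := exists_pow_of_prime hp hH (a := ⟨a, ha⟩) (b := (⟨b, hb⟩ : φ.ker))
      (fun h => ha1 (congrArg Subtype.val h))
    have hk' : a ^ k = b := congrArg Subtype.val hk
    rw [← hk']
    exact F_pow hF h1 a k
  have hne₀' : h₀ ≠ 1 := fun h => hne₀ (Subtype.ext h)
  have hc : ∀ h, φ h = 1 → h ≠ 1 → F h = F h₀ := fun h hh hh1 =>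
    le_antisymm (hle _ _ hh hh₀ hh1) (hle _ _ hh₀ hh hne₀')
  set c := F h₀ with hcdef
  -- the maximum m
  have hQ : (Finset.univ.filter (fun g => ψ g ≠ 1)).Nonempty :=
    ⟨h₀, by simpa using fun h => hne₀' (hinj h₀ hh₀ h)⟩
  obtain ⟨t, ht, htmax⟩ := Finset.exists_max_image _ F hQ
  simp only [Finset.mem_filter, Finset.mem_univ, true_and] at ht htmax
  set m := F t with hm
  have hcm : c ≤ m := htmax h₀ (fun h => hne₀' (hinj h₀ hh₀ h))
  -- sums over kernels
  have hker : ∀ Φ : ℤ → ℤ, ∑ h ∈ Finset.univ.filter (fun k => φ k = 1), Φ (F h) =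
      Φ (F 1) + (p - 1) * Φ c := by
    intro Φ
    have hmem : (1 : G) ∈ Finset.univ.filter (fun k => φ k = 1) := by simp
    rw [← Finset.add_sum_erase _ _ hmem]
    congr 1
    rw [Finset.sum_congr rfl (g := fun _ => Φ c)]
    · rw [Finset.sum_const, Finset.card_erase_of_mem hmem]
      have : (Finset.univ.filter (fun k => φ k = 1)).card = p := by
        rw [← hH, Nat.card_eq_fintype_card]
        rw [Fintype.card_subtype]
        simp [MonoidHom.mem_ker]
      rw [this, nsmul_eq_mul]
      push_cast [Nat.cast_sub hp.one_le]
      ring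
    · intro h hh
      rw [Finset.mem_erase, Finset.mem_filter] at hh
      rw [hc h hh.2.2 hh.1]
  -- total sum via ψ
  have htot1 : ∑ g, min m (F g) = p * D := by
    rw [← Finset.sum_fiberwise_of_maps_to (s := Finset.univ) (t := Finset.univ) (g := ψ)
      (fun _ _ => Finset.mem_univ _)]
    rw [Finset.sum_congr rfl (g := fun _ => D)]
    · rw [Finset.sum_const, Finset.card_univ, ← Nat.card_eq_fintype_card, hB, nsmul_eq_mul]
    · intro σ _
      by_cases hσ : σ = 1
      · subst hσ
        rw [← hD _ ht, fiber_sum]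
        apply Finset.sum_congr rfl
        intro n hn
        rw [Finset.mem_filter] at hn
        refine (isosceles hF hinv ?_).symm
        apply htmax
        rw [map_mul, hn.2, mul_one]; exact ht
      · rw [← hD σ hσ]
        apply Finset.sum_congr rfl
        intro g hg
        rw [Finset.mem_filter] at hg
        apply min_eq_right
        apply htmax
        rw [hg.2]; exact hσ
  -- fibers of φ
  have hfib : ∀ τ : A, ∃ μ : ℤ, (∃ g, φ g = τ ∧ F g = μ) ∧ (∀ g, φ g = τ → F g ≤ μ) ∧
      ∀ Φ : ℤ → ℤ, ∑ g ∈ Finset.univ.filter (fun g => φ g = τ), Φ (F g) =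
        Φ μ + (p - 1) * Φ (min μ c) := by
    intro τ
    obtain ⟨g₁, hg₁⟩ := hφ τ
    obtain ⟨g, hg, hgmax⟩ := Finset.exists_max_image (Finset.univ.filter (fun g => φ g = τ)) F
      ⟨g₁, by simpa using hg₁⟩
    simp only [Finset.mem_filter, Finset.mem_univ, true_and] at hg hgmax
    refine ⟨F g, ⟨g, hg, rfl⟩, hgmax, fun Φ => ?_⟩
    rw [← hg, fiber_sum φ g (fun k => Φ (F k)), Finset.sum_congr rfl
      (g := fun h => (fun s => Φ (min (F g) s)) (F h)), hker (fun s => Φ (min (F g) s)),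
      min_eq_left (h1 g)]
    intro h hh
    rw [Finset.mem_filter] at hh
    have : F (g * h) = min (F g) (F h) := isosceles hF hinv
      (hgmax _ (by rw [map_mul, hh.2, mul_one, hg]))
    simp only [this]
  have hp1 : (0:ℤ) ≤ p - 1 := by have : (2:ℤ) ≤ p := by exact_mod_cast hp2
                                 omega
  refine ⟨m, c, hcm, hc, ?_, ?_⟩
  · intro x hx
    rw [← htot1]
    rw [← Finset.sum_fiberwise_of_maps_to (s := Finset.univ) (t := Finset.univ) (g := φ)
      (fun _ _ => Finset.mem_univ _), mul_add, hx, Finset.mul_sum,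
      ← Finset.add_sum_erase _ _ (Finset.mem_univ (1 : A))]
    congr 1
    · rw [hker (fun s => min m s), min_eq_left (h1 t), min_eq_right hcm]
    · apply Finset.sum_congr rfl
      intro τ hτ
      have hτ1 := Finset.ne_of_mem_erase hτ
      obtain ⟨μ, -, -, hμ⟩ := hfib τ
      rw [hμ (fun s => min m s), mul_min_of_nonneg _ _ (by positivity : (0:ℤ) ≤ r), hf τ hτ1, hx,
        hμ (fun s => s)]
      rcases le_total m μ with h | h
      · rw [min_eq_left h]
        have h2 : min μ c = c := min_eq_right (hcm.trans h)
        rw [h2, min_eq_right hcm, min_eq_left]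
        omega
      · have h3 : min μ c ≤ c := min_le_right _ _
        have h4 : (p - 1 : ℤ) * min μ c ≤ (p - 1) * c := mul_le_mul_of_nonneg_left h3 hp1
        rw [min_eq_right h, min_eq_right (h3.trans hcm)]
        exact (min_eq_right (add_le_add h h4)).symm
  · intro hlt
    refine ⟨φ t, ?_, ?_⟩
    · intro h
      have : F t = c := hc t h (by rintro rfl; exact ht (map_one _))
      omega
    · rw [hf]
      · obtain ⟨μ, ⟨g, hg, hgμ⟩, hmax, hμ⟩ := hfib (φ t)
        rw [hμ (fun s => s)]
        have hmμ : m ≤ μ := hmax t rfl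
        have : μ = m := by
          by_contra hne
          have hgt : m < μ := lt_of_le_of_ne hmμ (Ne.symm hne)
          have hψg : ψ g = 1 := by
            by_contra hψ
            have := htmax g hψ
            omega
          have h5 := hF t⁻¹ g
          rw [hinv, hgμ, min_eq_left hmμ] at h5
          have h6 := hc (t⁻¹ * g) (by rw [map_mul, map_inv, hg, inv_mul_cancel])
            (by
              intro h7
              rw [inv_mul_eq_one] at h7
              rw [h7] at ht
              exact ht hψg)
          omega
        rw [this, min_eq_right hcm]
      · intro h
        have : F t = c := hc t h (by rintro rfl; exact ht (map_one _))
        omega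

end comb


namespace DVal

open IsLocalRing Polynomial

section
variable {K L : Type*} [Field K] [Field L] [Algebra K L] [FiniteDimensional K L] [IsGalois K L]
  {u : DVal K} {w : DVal L} {e : ℕ}

/-- The inertia subgroup. -/
def inertiaSubgroup (h : Ext u w e) : Subgroup (L ≃ₐ[K] L) where
  carrier := {σ | inInertia K w σ}
  one_mem' := fun z _ => Or.inl (by simp)
  mul_mem' := fun {σ τ} hσ hτ z hz => by
    have h1 : w.ge 1 (σ (τ z - z)) := (h.inv_ge σ).2 (hτ z hz)
    have h2 : w.ge 1 (σ z - z) := hσ z hz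
    have h3 := h1.add h2
    have h4 : (σ * τ) z - z = σ (τ z - z) + (σ z - z) := by
      rw [AlgEquiv.mul_apply, map_sub]; ring
    rw [h4]; exact h3
  inv_mem' := fun {σ} hσ z hz => by
    have h1 : w.ge 1 (σ (σ⁻¹ z) - σ⁻¹ z) := hσ _ ((h.inv_ge σ⁻¹).2 hz)
    have h4 : σ⁻¹ z - z = -(σ (σ⁻¹ z) - σ⁻¹ z) := by
      rw [← AlgEquiv.mul_apply, mul_inv_cancel]; simp
    rw [h4]; exact h1.neg

lemma Ext.all_inertia (h : Ext u w e) (he : e = Module.finrank K L) (σ : L ≃ₐ[K] L) :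
    inInertia K w σ := by
  have h1 : e ∣ Nat.card (inertiaSubgroup h) := h.main.1
  have h2 := Subgroup.card_subgroup_dvd_card (inertiaSubgroup h)
  have h3 : inertiaSubgroup h = ⊤ := (Subgroup.card_eq_iff_eq_top _).1 (Nat.dvd_antisymm h2
    (by rw [IsGalois.card_aut_eq_finrank]; exact (dvd_of_eq he.symm).trans h1))
  have h4 : σ ∈ inertiaSubgroup h := by rw [h3]; trivial
  exact h4

lemma tame_ramNum (h : Ext u w e) {p : ℕ} (hp0 : (p : L) ≠ 0) (hpv : w.v (p : L) = 0)
    {σ : L ≃ₐ[K] L} (hσ : inInertia K w σ) {π : L} (hπ : π ≠ 0 ∧ w.v π = 1)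
    (hσp : σ ^ p = 1) (hσ1 : σ ≠ 1) : ramNum K w π σ = 0 := by
  have h1 : ¬ w.ge 2 (σ π - π) := fun h2 =>
    hσ1 (tame_eq_one hp0 hpv (h.inv σ) hσ hπ h2 hσp)
  have h2 : σ π - π ≠ 0 := fun h0 => h1 (Or.inl h0)
  have h3 : ¬ 2 ≤ w.v (σ π - π) := fun h0 => h1 (Or.inr h0)
  have h4 : 1 ≤ w.v (σ π - π) := ge.le (w := w) (hσ π (Or.inr (by omega))) h2
  unfold ramNum
  simp only [hσ, if_true]
  omega

lemma ge_natCast (n : ℕ) : u.ge 0 (n : K) := by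
  induction n with
  | zero => left; simp
  | succ n ih => push_cast; exact ih.add ge_one

end

lemma hherb_zero {K L : Type*} [Field K] [Field L] [Algebra K L] (w : DVal L) (π : L) :
    hherb K w π 0 = 0 := by
  unfold hherb; simp

end DVal


namespace DVal

open IsLocalRing Polynomial

section
variable {K M : Type*} [Field K] [Field M] [Algebra K M] [FiniteDimensional K M]

lemma galois_of_sup (L E : IntermediateField K M) (hM : L ⊔ E = ⊤)
    [IsGalois K L] [IsGalois K E] : IsGalois K M := by
  have h1 : Normal K ↥(L ⊔ E) := IntermediateField.normal_sup K M L E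
  have h2 : Algebra.IsSeparable K ↥(L ⊔ E) := IntermediateField.isSeparable_sup (F := K) (E := M) L E
  have h3 : IsGalois K ↥(L ⊔ E) := ⟨⟩
  rw [hM] at h3
  exact IsGalois.of_algEquiv IntermediateField.topEquiv

variable [IsGalois K M]

lemma restrict_inj (L E : IntermediateField K M) (hM : L ⊔ E = ⊤)
    [IsGalois K L] [IsGalois K E] (g : M ≃ₐ[K] M)
    (h1 : AlgEquiv.restrictNormalHom L g = 1) (h2 : AlgEquiv.restrictNormalHom E g = 1) :
    g = 1 := by
  have h3 : g ∈ L.fixingSubgroup := by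
    rw [← IntermediateField.restrictNormalHom_ker]; exact h1
  have h4 : g ∈ E.fixingSubgroup := by
    rw [← IntermediateField.restrictNormalHom_ker]; exact h2
  have h5 : g ∈ (L ⊔ E).fixingSubgroup := by
    rw [IntermediateField.fixingSubgroup_sup]; exact ⟨h3, h4⟩
  rw [hM, IntermediateField.fixingSubgroup_top] at h5
  exact h5

lemma card_ker_eq {p : ℕ} (hp : p.Prime) (L E : IntermediateField K M) (hM : L ⊔ E = ⊤)
    [IsGalois K L] [IsGalois K E] (hE_deg : Module.finrank K E = p) (hEL : ¬ E ≤ L) :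
    Nat.card (AlgEquiv.restrictNormalHom (F := K) (K₁ := M) L).ker = p ∧
      Module.finrank L M = p := by
  have h1 : Nat.card (AlgEquiv.restrictNormalHom (F := K) (K₁ := M) L).ker =
      Module.finrank L M := by
    rw [IntermediateField.restrictNormalHom_ker]
    exact IsGalois.card_fixingSubgroup_eq_finrank L
  have h2 : Nat.card (AlgEquiv.restrictNormalHom (F := K) (K₁ := M) L).ker ∣
      Nat.card (E ≃ₐ[K] E) := by
    refine Subgroup.card_dvd_of_injective
      ((AlgEquiv.restrictNormalHom (F := K) (K₁ := M) E).comp (Subgroup.subtype _)) ?_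
    rw [injective_iff_map_eq_one]
    intro g hg
    exact Subtype.ext (restrict_inj L E hM _ g.2 hg)
  rw [IsGalois.card_aut_eq_finrank, hE_deg, Nat.dvd_prime hp] at h2
  rcases h2 with h2 | h2
  · exfalso
    rw [h1] at h2
    have : L = ⊤ := IntermediateField.finrank_eq_one_iff_eq_top.1 h2
    exact hEL (this ▸ le_top)
  · exact ⟨h2, h1 ▸ h2⟩

lemma Ext.v_natCast {L : Type*} [Field L] [Algebra K L] {u : DVal K} {w : DVal L} {e : ℕ}
    (h : Ext u w e) {p : ℕ} (hp0 : (p : K) ≠ 0) (hpv : u.v (p : K) = 0) :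
    (p : L) ≠ 0 ∧ w.v (p : L) = 0 := by
  have h1 := h.map p hp0
  rw [map_natCast, hpv] at h1
  refine ⟨fun h0 => hp0 ?_, by simpa using h1⟩
  have : algebraMap K L p = algebraMap K L 0 := by rw [map_natCast, h0, map_zero]
  exact (algebraMap K L).injective this

lemma pow_eq_one_of_card {p : ℕ} {G : Type*} [Group G] (h : Nat.card G = p) (g : G) :
    g ^ p = 1 := by
  rw [← h]; exact pow_card_eq_one'

lemma tame_case {p : ℕ} (hp : p.Prime) {L E : IntermediateField K M}
    [IsGalois K L] [IsGalois K E] (hE_deg : Module.finrank K E = p)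
    (hfin : Module.finrank L M = p)
    {vK : DVal K} {vL : DVal L} {vE : DVal E} {vM : DVal M} {eL eML d : ℕ}
    (huL : Ext vK vL eL) (hLM : Ext vL vM eML) (huE : Ext vK vE p) (hed : eML * eL = d * p)
    {πL : L} (hπL : πL ≠ 0 ∧ vL.v πL = 1) {πE : E} (hπE : πE ≠ 0 ∧ vE.v πE = 1)
    {πM : M} (hπM : πM ≠ 0 ∧ vM.v πM = 1) {vbr : ℤ}
    (hvbr : ∀ σ : E ≃ₐ[K] E, σ ≠ 1 → ramNum K vE πE σ = vbr)
    (hnontriv : ∃ σ : E ≃ₐ[K] E, σ ≠ 1)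
    (hnot : ¬ IsUpperBreak K vL πL (vbr : ℝ)) (ht : ¬ vK.ge 1 (p : K))
    (σ : M ≃ₐ[L] M) (hσ : σ ≠ 1) :
    hherb K vL πL ((ramNum L vM πM σ : ℤ) : ℝ) = (vbr : ℝ) := by
  have hp0 : (p : K) ≠ 0 := fun h => ht (Or.inl h)
  have hpv : vK.v (p : K) = 0 := by
    have h1 : 0 ≤ vK.v (p : K) := (ge_natCast p).le hp0
    have h2 : ¬ 1 ≤ vK.v (p : K) := fun h => ht (Or.inr h)
    omega
  obtain ⟨hL0, hLv⟩ := huL.v_natCast hp0 hpv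
  obtain ⟨hE0, hEv⟩ := huE.v_natCast hp0 hpv
  obtain ⟨hM0, hMv⟩ := hLM.v_natCast hL0 hLv
  have hv0 : vbr = 0 := by
    obtain ⟨τ, hτ⟩ := hnontriv
    rw [← hvbr τ hτ]
    refine tame_ramNum huE hE0 hEv (huE.all_inertia hE_deg.symm τ) hπE ?_ hτ
    exact pow_eq_one_of_card (by rw [IsGalois.card_aut_eq_finrank, hE_deg]) τ
  have hpe : ¬ p ∣ eL := by
    intro hdvd
    have h1 : p ∣ Nat.card (inertiaSubgroup huL) := hdvd.trans huL.main.1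
    haveI := Fact.mk hp
    obtain ⟨τ, hτ⟩ := exists_prime_orderOf_dvd_card' p h1
    have hτp : (τ : L ≃ₐ[K] L) ^ p = 1 := by
      have := pow_orderOf_eq_one τ
      rw [hτ] at this
      exact_mod_cast congrArg Subtype.val this
    have hτ1 : (τ : L ≃ₐ[K] L) ≠ 1 := by
      intro h
      have : τ = 1 := Subtype.ext h
      rw [this, orderOf_one] at hτ
      exact hp.one_lt.ne hτ
    refine hnot ⟨0, ⟨τ, hτ1, ?_⟩, ?_⟩
    · rw [tame_ramNum huL hL0 hLv τ.2 hπL hτp hτ1]; simp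
    · rw [hherb_zero, hv0]; simp
  have hpe2 : p ∣ eML := by
    have : p ∣ eML * eL := hed ▸ dvd_mul_left p d
    exact (hp.dvd_mul.1 this).resolve_right hpe
  have h3 : eML = p := Nat.dvd_antisymm (hfin ▸ hLM.dvd_card) hpe2
  have h4 : ramNum L vM πM σ = 0 := by
    refine tame_ramNum hLM hM0 hMv (hLM.all_inertia (h3.trans hfin.symm) σ) hπM ?_ hσ
    exact pow_eq_one_of_card (by rw [IsGalois.card_aut_eq_finrank, hfin]) σ
  rw [h4, hv0]
  simp [hherb_zero]

lemma wild_case {p : ℕ} (hp : p.Prime) {L E : IntermediateField K M} (hM : L ⊔ E = ⊤)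
    [IsGalois K L] [IsGalois K E] (hE_deg : Module.finrank K E = p)
    (hker : Nat.card (AlgEquiv.restrictNormalHom (F := K) (K₁ := M) L).ker = p)
    (hfin : Module.finrank L M = p)
    {vK : DVal K} {vL : DVal L} {vE : DVal E} {vM : DVal M} {eL eML d : ℕ}
    (huL : Ext vK vL eL) (hLM : Ext vL vM eML) (huM : Ext vK vM (eML * eL))
    (huE : Ext vK vE p) (hEM : Ext vE vM d) (hd : 0 < d) (hed : eML * eL = d * p)
    {πL : L} (hπL : πL ≠ 0 ∧ vL.v πL = 1) {πE : E} (hπE : πE ≠ 0 ∧ vE.v πE = 1)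
    {πM : M} (hπM : πM ≠ 0 ∧ vM.v πM = 1) {vbr : ℤ}
    (hvbr : ∀ σ : E ≃ₐ[K] E, σ ≠ 1 → ramNum K vE πE σ = vbr)
    (hnontriv : ∃ σ : E ≃ₐ[K] E, σ ≠ 1)
    (hnot : ¬ IsUpperBreak K vL πL (vbr : ℝ)) (hr : ResPerf vK.O p)
    (σ : M ≃ₐ[L] M) (hσ : σ ≠ 1) :
    hherb K vL πL ((ramNum L vM πM σ : ℤ) : ℝ) = (vbr : ℝ) := by
  classical
  obtain ⟨-, hmM⟩ := huM.main
  obtain ⟨hrM, -, x, hx⟩ := hmM p hp hr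
  obtain ⟨-, hmL⟩ := huL.main
  obtain ⟨hrL, -, yL, hyL⟩ := hmL p hp hr
  obtain ⟨-, hmE⟩ := huE.main
  obtain ⟨hrE, -, yE, hyE⟩ := hmE p hp hr
  replace hx : IsGen vK vM x := hx
  replace hyL : IsGen vK vL yL := hyL
  replace hyE : IsGen vK vE yE := hyE
  have hxne : ∀ g : M ≃ₐ[K] M, g ≠ 1 → g x - x ≠ 0 := fun g hg =>
    (IsGen.ramNum (fun c hc => huM.ge_map.2 hc) hx hrM (huM.inv g) hπM hg).1
  have hx0 : ∀ g : M ≃ₐ[K] M, g ≠ 1 → 0 ≤ vM.v (g x - x) := fun g hg =>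
    (IsGen.ramNum (fun c hc => huM.ge_map.2 hc) hx hrM (huM.inv g) hπM hg).2.2
  have hvb : 0 ≤ vbr := by
    obtain ⟨τ, hτ⟩ := hnontriv
    have h1 := huE.all_inertia hE_deg.symm τ
    obtain ⟨h2, h3, h4⟩ :=
      IsGen.ramNum (fun c hc => huE.ge_map.2 hc) hyE hrE (huE.inv τ) hπE hτ
    have h5 : 1 ≤ vE.v (τ yE - yE) := ge.le (w := vE) (h1 yE hyE.1) h2
    rw [hvbr τ hτ] at h3
    omega
  let T : ℤ := ∑ g : M ≃ₐ[K] M, |vM.v (g x - x)|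
  have hT : ∀ g : M ≃ₐ[K] M, vM.v (g x - x) ≤ T := fun g =>
    (le_abs_self _).trans
      (Finset.single_le_sum (f := fun g : M ≃ₐ[K] M => |vM.v (g x - x)|)
        (fun i _ => abs_nonneg _) (Finset.mem_univ g))
  let F : (M ≃ₐ[K] M) → ℤ := fun g => if g = 1 then T else vM.v (g x - x)
  have hF1 : F 1 = T := by simp [F]
  have hFn : ∀ g, g ≠ 1 → F g = vM.v (g x - x) := fun g hg => by simp [F, hg]
  have hFT : ∀ g, F g ≤ T := fun g => by
    by_cases hg : g = 1
    · rw [hg, hF1]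
    · rw [hFn g hg]; exact hT g
  have hFge : ∀ g n, n ≤ F g → vM.ge n (g x - x) := fun g n hn => by
    by_cases hg : g = 1
    · left; rw [hg]; simp
    · right; rw [← hFn g hg]; exact hn
  have hFmul : ∀ g h, min (F g) (F h) ≤ F (g * h) := by
    intro g h
    by_cases hgh : g * h = 1
    · rw [hgh, hF1]; exact (min_le_left _ _).trans (hFT g)
    · rw [hFn _ hgh]
      have h1 : vM.ge (min (F g) (F h)) (g (h x - x)) :=
        (huM.inv_ge g).2 (hFge h _ (min_le_right _ _))
      have h2 := h1.add (hFge g _ (min_le_left (F g) (F h)))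
      have h3 : (g * h) x - x = g (h x - x) + (g x - x) := by
        rw [AlgEquiv.mul_apply, map_sub]; ring
      rw [← h3] at h2
      exact h2.le (hxne _ hgh)
  have hFinv : ∀ g, F g⁻¹ = F g := by
    intro g
    by_cases hg : g = 1
    · rw [hg, inv_one]
    · rw [hFn _ hg, hFn _ (inv_ne_one.2 hg), ← huM.inv g (g⁻¹ x - x), map_sub,
        ← AlgEquiv.mul_apply, mul_inv_cancel, AlgEquiv.one_apply, v_sub_comm]
  have hsumF : ∀ {N : IntermediateField K M} [IsGalois K N] (τ : N ≃ₐ[K] N), τ ≠ 1 →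
      ∑ g ∈ Finset.univ.filter (fun g => AlgEquiv.restrictNormalHom (K₁ := M) N g = τ), F g =
      ∑ g ∈ Finset.univ.filter (fun g => AlgEquiv.restrictNormalHom (K₁ := M) N g = τ),
        vM.v (g x - x) := by
    intro N _ τ hτ
    refine Finset.sum_congr rfl fun g hg => hFn g ?_
    rintro rfl
    rw [Finset.mem_filter, map_one] at hg
    exact hτ hg.2.symm
  have hD : ∀ τ : E ≃ₐ[K] E, τ ≠ 1 →
      ∑ g ∈ Finset.univ.filter (fun g => AlgEquiv.restrictNormalHom (K₁ := M) E g = τ), F g =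
        d * (vbr + 1) := by
    intro τ hτ
    obtain ⟨h2, h3, h4⟩ :=
      IsGen.ramNum (fun c hc => huE.ge_map.2 hc) hyE hrE (huE.inv τ) hπE hτ
    rw [hsumF τ hτ, ← herbrand huE huM hEM hx hyE h2 hxne, ← h3, hvbr τ hτ]
  have hf : ∀ τ : L ≃ₐ[K] L, τ ≠ 1 → (eML : ℤ) * vL.v (τ yL - yL) =
      ∑ g ∈ Finset.univ.filter (fun g => AlgEquiv.restrictNormalHom (K₁ := M) L g = τ), F g := by
    intro τ hτ
    obtain ⟨h2, h3, h4⟩ :=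
      IsGen.ramNum (fun c hc => huL.ge_map.2 hc) hyL hrL (huL.inv τ) hπL hτ
    rw [hsumF τ hτ, ← herbrand huL huM hLM hx hyL h2 hxne]
  obtain ⟨m, c, hcm, hc, hid, hlt⟩ := comb_core p hp
    (AlgEquiv.restrictNormalHom (F := K) (K₁ := M) L)
    (AlgEquiv.restrictNormalHom (F := K) (K₁ := M) E)
    (AlgEquiv.restrictNormalHom_surjective M) (AlgEquiv.restrictNormalHom_surjective M)
    (by rw [IsGalois.card_aut_eq_finrank, hE_deg]) hker (restrict_inj L E hM)
    F hFmul hFinv (fun g => by rw [hF1]; exact hFT g) (d * (vbr + 1)) hD eML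
    (fun τ => vL.v (τ yL - yL)) hf
  have hpp : 2 ≤ p := hp.two_le
  -- conversion of the numerical identity into a value of the Herbrand function
  have hconv : ∀ z : ℤ, 1 ≤ z → (eML : ℤ) * z = m + ((p : ℤ) - 1) * c →
      hherb K vL πL ((z - 1 : ℤ) : ℝ) = vbr := by
    intro z hz hzm
    have h1 := hid z hzm
    obtain ⟨n, rfl⟩ : ∃ n : ℕ, z = n + 1 := ⟨(z - 1).toNat, by omega⟩
    have h2 := hherb_wild huL hp hr hπL hyL n
    have h3 : ((n + 1 - 1 : ℤ) : ℝ) = (n : ℝ) := by push_cast; ring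
    rw [h3]
    have h4 : (p : ℝ) * (d * (vbr + 1)) = eML * (eL * (hherb K vL πL n + 1)) := by
      rw [h2]; exact_mod_cast h1
    have h5 : (eML : ℝ) * eL = d * p := by exact_mod_cast hed
    have h6 : (d : ℝ) * p * (vbr + 1) = d * p * (hherb K vL πL n + 1) := by
      linear_combination h4 + (hherb K vL πL n + 1) * h5
    have h7 : (d : ℝ) * p ≠ 0 := by
      have : (0 : ℝ) < d := by exact_mod_cast hd
      have : (0 : ℝ) < p := by exact_mod_cast hp.pos
      positivity
    have h8 := mul_left_cancel₀ h7 h6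
    linarith
  -- elements of Gal(M/L)
  let ι : (M ≃ₐ[L] M) → (M ≃ₐ[K] M) := fun τ => τ.restrictScalars K
  have hι1 : ∀ τ, τ ≠ 1 → ι τ ≠ 1 := by
    intro τ hτ h
    apply hτ
    ext z
    exact DFunLike.congr_fun h z
  have hιk : ∀ τ, AlgEquiv.restrictNormalHom (F := K) (K₁ := M) L (ι τ) = 1 := by
    intro τ
    have : ι τ ∈ L.fixingSubgroup := by
      rw [IntermediateField.mem_fixingSubgroup_iff]
      intro z hz
      exact τ.commutes ⟨z, hz⟩
    rw [← IntermediateField.restrictNormalHom_ker] at this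
    exact this
  have hcv : ∀ τ : M ≃ₐ[L] M, τ ≠ 1 → vM.v (τ x - x) = c := by
    intro τ hτ
    have h1 := hc (ι τ) (hιk τ) (hι1 τ hτ)
    rw [hFn _ (hι1 τ hτ)] at h1
    exact h1
  have hc0 : 0 ≤ c := by
    rw [← hcv σ hσ]
    exact hx0 (ι σ) (hι1 σ hσ)
  rcases hcm.lt_or_eq with hcm | hcm
  · exfalso
    obtain ⟨τ, hτ, hτm⟩ := hlt hcm
    obtain ⟨h2, h3, h4⟩ :=
      IsGen.ramNum (fun c hc => huL.ge_map.2 hc) hyL hrL (huL.inv τ) hπL hτ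
    have h5 : 1 ≤ vL.v (τ yL - yL) := by
      by_contra hlt
      have h6 : vL.v (τ yL - yL) = 0 := by omega
      simp only [h6, mul_zero] at hτm
      have : 0 ≤ ((p : ℤ) - 1) * c := mul_nonneg (by omega) hc0
      omega
    refine hnot ⟨_, ⟨τ, hτ, rfl⟩, ?_⟩
    have := hconv _ h5 hτm
    rwa [← h3, add_sub_cancel_right] at this
  · subst hcm
    have hcpos : 1 ≤ c := by
      by_contra hlt
      have h6 : c = 0 := by omega
      subst h6
      have h1 := hid 0 (by simp)
      have h2 : ∑ τ ∈ Finset.univ.erase (1 : L ≃ₐ[K] L), min 0 (vL.v (τ yL - yL)) = 0 := by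
        refine Finset.sum_eq_zero fun τ hτ => ?_
        obtain ⟨h2, h3, h4⟩ :=
          IsGen.ramNum (fun c hc => huL.ge_map.2 hc) hyL hrL (huL.inv τ) hπL
            (Finset.ne_of_mem_erase hτ)
        exact min_eq_left h4
      rw [h2] at h1
      have h3 : (0 : ℤ) < p := by exact_mod_cast hp.pos
      have h4 : (0 : ℤ) < d := by exact_mod_cast hd
      have h5 : (0 : ℤ) < vbr + 1 := by omega
      have : (0 : ℤ) < p * (d * (vbr + 1)) := by positivity
      simp at h1
      omega
    have hxL : IsGen vL vM x := by
      refine ⟨hx.1, fun z hz => ?_⟩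
      obtain ⟨g, hg, hgz⟩ := hx.2 z hz
      refine ⟨g.map (algebraMap K L), fun n => ?_, ?_⟩
      · rw [coeff_map]; exact huL.ge_map.2 (hg n)
      · rw [aeval_map_algebraMap]; exact hgz
    have hall : ∀ τ : M ≃ₐ[L] M, inInertia L vM τ := by
      intro τ z hz
      refine IsGen.ge_sub (fun c hc => hLM.ge_map.2 hc) hxL (hLM.inv τ) ?_ hz
      by_cases hτ : τ = 1
      · left; rw [hτ]; simp
      · right; rw [hcv τ hτ]; exact hcpos
    have heMLp : eML = p := by
      have h1 := (hLM.main.2 p hp hrL).2.1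
      rw [← h1, ← hfin, ← IsGalois.card_aut_eq_finrank]
      exact Nat.card_congr (Equiv.subtypeUnivEquiv hall)
    obtain ⟨h2, h3, h4⟩ :=
      IsGen.ramNum (fun c hc => hLM.ge_map.2 hc) hxL hrM (hLM.inv σ) hπM hσ
    rw [hcv σ hσ] at h3
    have h5 := hconv c hcpos (by rw [heMLp]; ring)
    rwa [← h3, add_sub_cancel_right] at h5

end

end DVal

theorem break_of_compositum (p : ℕ) (hp : p.Prime)
    (K : Type*) [Field K]
    (vK : DVal K) (hcomplete : vK.IsComplete) (hperf : vK.PerfectResidue p)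
    -- M is the compositum LE, containing L and E as intermediate fields:
    (M : Type*) [Field M] [Algebra K M] [FiniteDimensional K M]
    (L E : IntermediateField K M) (hM : L ⊔ E = ⊤)
    [IsGalois K ↥L] [IsGalois K ↥E]
    (hE_deg : Module.finrank K ↥E = p)
    (hEL : ¬ E ≤ L)
    -- normalized valuations on L, E and M = LE:
    (vL : DVal ↥L) (vE : DVal ↥E) (vM : DVal M)
    (eL : ℕ) (heL : ∀ x : K, x ≠ 0 → vL.v (algebraMap K ↥L x) = eL * vK.v x)
    -- E/K is ramified (being of degree p, totally ramified):
    (heE : ∀ x : K, x ≠ 0 → vE.v (algebraMap K ↥E x) = p * vK.v x)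
    (eML : ℕ) (heML : ∀ x : ↥L, x ≠ 0 → vM.v (algebraMap ↥L M x) = eML * vL.v x)
    (hinvL : ∀ σ : ↥L ≃ₐ[K] ↥L, ∀ x : ↥L, vL.v (σ x) = vL.v x)
    (hinvM : ∀ σ : M ≃ₐ[↥L] M, ∀ x : M, vM.v (σ x) = vM.v x)
    (πL : ↥L) (hπL : πL ≠ 0 ∧ vL.v πL = 1)
    (πE : ↥E) (hπE : πE ≠ 0 ∧ vE.v πE = 1)
    (πM : M) (hπM : πM ≠ 0 ∧ vM.v πM = 1)
    -- v is the unique (upper and lower) ramification break of E/K: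
    (vbr : ℤ)
    (hvbr : ∀ σ : ↥E ≃ₐ[K] ↥E, σ ≠ 1 → ramNum K vE πE σ = vbr)
    (hnontriv : ∃ σ : ↥E ≃ₐ[K] ↥E, σ ≠ 1)
    -- v is not an upper ramification break of L/K:
    (hnot : ¬ IsUpperBreak K vL πL (vbr : ℝ)) :
    -- then the ramification break of LE/L is ψ_{L/K}(v):
    ∀ σ : M ≃ₐ[↥L] M, σ ≠ 1 →
      hherb K vL πL ((ramNum ↥L vM πM σ : ℤ) : ℝ) = (vbr : ℝ) := by
  haveI : IsGalois K M := DVal.galois_of_sup L E hM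
  have huL : DVal.Ext vK vL eL := ⟨heL, hinvL⟩
  have hLM : DVal.Ext vL vM eML := ⟨heML, hinvM⟩
  have huM := huL.trans hLM
  obtain ⟨d, hd, hEM, huE, hed⟩ := huM.descend hp.pos heE
  obtain ⟨hker, hfin⟩ := DVal.card_ker_eq hp L E hM hE_deg hEL
  intro σ hσ
  by_cases ht : vK.ge 1 (p : K)
  · have hr : ResPerf vK.O p := by
      refine ⟨DVal.mem_maximalIdeal_O.2 (by simpa using ht), fun a => ?_⟩
      obtain ⟨y, hy, hxy⟩ := hperf a a.2
      exact ⟨⟨y, hy⟩, DVal.mem_maximalIdeal_O.2 hxy⟩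
    exact DVal.wild_case hp hM hE_deg hker hfin huL hLM huM huE hEM hd hed hπL hπE hπM hvbr
      hnontriv hnot hr σ hσ
  · exact DVal.tame_case hp hE_deg hfin huL hLM huE hed hπL hπE hπM hvbr hnontriv hnot ht σ hσ
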